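/- Let W be a vector space over ℂ and let V be a subspace of ℰ(W) = Hom(W, W((x))) such that every ordered sequence in V of length 2 or 3 is quasi compatible, such that V contains the identity operator 1_W, and such that V is closed (i.e., a(x)_n b(x) ∈ V for all a(x), b(x) ∈ V and n ∈ ℤ). Then (V, Y_ℰ, 1_W) carries the structure of a nonlocal vertex algebra, and W is a faithful quasi V-module where the vertex operator map Y_W is given by Y_W(α(x), x₀) = α(x₀) for α(x) ∈ V. -/

import Mathlib

noncomputable section

open Classical

namespace NVA

/-! ### The space ℰ(W) = Hom(W, W((x))), coefficient-indexed by modes: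
`a w n` is the mode `a_n` applied to `w`, where `a(x)w = ∑ (a_n w) x^{-n-1}`.
Lower truncation of `a(x)w` in powers of `x` means `a_n w = 0` for `n` large. -/

variable (W : Type*) [AddCommGroup W] [Module ℂ W]

/-- `ℰ(W) = Hom(W, W((x)))` as a submodule of `Hom(W, W[[x^{±1}]])`. -/
def EWsub : Submodule ℂ (W →ₗ[ℂ] (ℤ → W)) where
  carrier := {a | ∀ w : W, ∃ N : ℤ, ∀ n : ℤ, N ≤ n → a w n = 0}
  add_mem' := by
    intro a b ha hb w
    obtain ⟨N, hN⟩ := ha w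
    obtain ⟨M, hM⟩ := hb w
    refine ⟨max N M, fun n hn => ?_⟩
    simp only [LinearMap.add_apply, Pi.add_apply,
      hN n (le_trans (le_max_left _ _) hn), hM n (le_trans (le_max_right _ _) hn), add_zero]
  zero_mem' := by intro w; exact ⟨0, fun n _ => rfl⟩
  smul_mem' := by
    intro c a ha w
    obtain ⟨N, hN⟩ := ha w
    exact ⟨N, fun n hn => by
      simp only [LinearMap.smul_apply, Pi.smul_apply, hN n hn, smul_zero]⟩

/-- The type `ℰ(W)`. -/
abbrev EW := ↥(EWsub W)

variable {W}

/-- The mode function of an element of `ℰ(W)`. -/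
def mf (a : EW W) : W → ℤ → W := fun w n => (a : W →ₗ[ℂ] (ℤ → W)) w n

/-- The identity operator `1_W`, as an element of `ℰ(W)`. -/
def oneE : EW W :=
  ⟨{ toFun := fun w n => if n = -1 then w else 0
     map_add' := by
       intro w w'; funext n; by_cases h : n = -1 <;> simp [h]
     map_smul' := by
       intro c w; funext n; by_cases h : n = -1 <;> simp [h] },
   fun w => ⟨0, fun n hn => if_neg (by omega)⟩⟩

/-- The generalized binomial coefficient `C(m, j)` for `m ∈ ℤ`, as a complex number. -/
def binom (m : ℤ) (j : ℕ) : ℂ :=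
  (∏ i ∈ Finset.range j, ((m : ℂ) - (i : ℂ))) / (j.factorial : ℂ)

/-- The coefficient of `x₁^m x₂^t` in `a(x₁) b(x₂) w`. -/
def Fab (a b : EW W) (w : W) (m t : ℤ) : W := mf a (mf b w (-t - 1)) (-m - 1)

/-- Multiplication of a two-variable family by a polynomial `p(x₁,x₂)`. -/
def mulPoly (p : MvPolynomial (Fin 2) ℂ) (F : ℤ → ℤ → W) : ℤ → ℤ → W :=
  fun m t => ∑ d ∈ p.support, MvPolynomial.coeff d p • F (m - d 0) (t - d 1)

/-- A two-variable family lies in `W((x₁,x₂))` (jointly lower truncated). -/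
def IsLaurent2 (F : ℤ → ℤ → W) : Prop :=
  ∃ N : ℤ, ∀ m t : ℤ, (m < N ∨ t < N) → F m t = 0

/-- Quasi compatibility of an ordered pair `(a(x), b(x))` in `ℰ(W)`:
`p(x₁,x₂) a(x₁) b(x₂) ∈ Hom(W, W((x₁,x₂)))` for some nonzero polynomial `p`. -/
def QCPair (a b : EW W) : Prop :=
  ∃ p : MvPolynomial (Fin 2) ℂ, p ≠ 0 ∧ ∀ w, IsLaurent2 (mulPoly p (Fab a b w))

/-! ### Sequences -/

/-- The coefficient of `x₁^{k 1} ⋯ x_r^{k r}` in `ψ₁(x₁) ⋯ ψ_r(x_r) w`. -/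
def seqCoeff : {r : ℕ} → (Fin r → EW W) → W → (Fin r → ℤ) → W
  | 0, _, w, _ => w
  | _ + 1, ψ, w, k => mf (ψ 0) (seqCoeff (Fin.tail ψ) w (Fin.tail k)) (-(k 0) - 1)

/-- The polynomial `∏_{1 ≤ i < j ≤ r} p(x_i, x_j)`. -/
def pairPoly (p : MvPolynomial (Fin 2) ℂ) (r : ℕ) : MvPolynomial (Fin r) ℂ :=
  ∏ ij ∈ Finset.univ.filter (fun ij : Fin r × Fin r => ij.1 < ij.2),
    MvPolynomial.rename ![ij.1, ij.2] p

/-- Multiplication of an `r`-variable family by a polynomial in `r` variables. -/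
def mulPolyN {r : ℕ} (P : MvPolynomial (Fin r) ℂ) (F : (Fin r → ℤ) → W) :
    (Fin r → ℤ) → W :=
  fun k => ∑ d ∈ P.support, MvPolynomial.coeff d P • F (fun i => k i - d i)

/-- An `r`-variable family lies in `W((x₁,…,x_r))`. -/
def IsLaurentN {r : ℕ} (F : (Fin r → ℤ) → W) : Prop :=
  ∃ N : ℤ, ∀ k : Fin r → ℤ, (∃ i, k i < N) → F k = 0

/-- Quasi compatibility of an ordered sequence in `ℰ(W)`. -/
def QCSeq {r : ℕ} (ψ : Fin r → EW W) : Prop :=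
  ∃ p : MvPolynomial (Fin 2) ℂ, p ≠ 0 ∧
    ∀ w, IsLaurentN (mulPolyN (pairPoly p r) (seqCoeff ψ w))

/-- Quasi compatibility of a subset of `ℰ(W)`. -/
def QCSet (S : Set (EW W)) : Prop :=
  ∀ (r : ℕ) (ψ : Fin r → EW W), (∀ i, ψ i ∈ S) → QCSeq ψ

/-! ### The vertex operation `Y_ℰ^{(α)}` -/

/-- `ℂ((x))`. -/
abbrev LC : Type := LaurentSeries ℂ

/-- An iterated Laurent series field, e.g. `ℂ((x))((x₀))` (outer variable the second one). -/
abbrev K2 : Type := HahnSeries ℤ LC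

/-- The outer variable of `K2`. -/
def xOuter : K2 := HahnSeries.single 1 1

/-- The inner variable of `K2`. -/
def xInner : K2 := HahnSeries.single 0 (HahnSeries.single 1 1)

/-- `α` times the inner variable of `K2`. -/
def xInnerC (c : ℂ) : K2 := HahnSeries.single 0 (HahnSeries.single 1 c)

/-- The polynomial `p(x₀ + α x, x)` as an element of `ℂ((x))((x₀))`
(outer variable `x₀`). -/
def qK (p : MvPolynomial (Fin 2) ℂ) (α : ℂ) : K2 :=
  MvPolynomial.aeval ![xOuter + xInnerC α, xInner] p

/-- The expansion `ι_{x,x₀} (p(x₀ + α x, x)^{-1}) ∈ ℂ((x))((x₀))`. -/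
def qInv (p : MvPolynomial (Fin 2) ℂ) (α : ℂ) : K2 := (qK p α)⁻¹

/-- The coefficient of `x₀^j x^t` in `(p(x₁,x) a(x₁) b(x) w)|_{x₁ = αx + x₀}`,
expanding via `(αx+x₀)^m = ∑_{j≥0} C(m,j) α^{m-j} x^{m-j} x₀^j`. -/
def substYE (α : ℂ) (p : MvPolynomial (Fin 2) ℂ) (a b : EW W) (w : W)
    (j : ℕ) (t : ℤ) : W :=
  ∑ᶠ m : ℤ, (binom m j * α ^ (m - (j : ℤ))) • mulPoly p (Fab a b w) m (t - m + j)

/-- The coefficient of `x₀^J x^T` in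
`ι_{x,x₀}(p(x₀+αx,x)^{-1}) ⬝ (p(x₁,x)a(x₁)b(x)w)|_{x₁ = αx+x₀}`. -/
def fullYE (α : ℂ) (p : MvPolynomial (Fin 2) ℂ) (a b : EW W) (w : W)
    (J T : ℤ) : W :=
  ∑ᶠ s : ℤ × ℤ, (((qInv p α).coeff s.1).coeff s.2) •
    (if 0 ≤ J - s.1 then substYE α p a b w (J - s.1).toNat (T - s.2) else 0)

/-- The raw mode family of `Y_ℰ^{(α)}(a(x), x₀) b(x)`; `rawYE α a b n w m` is the mode
`m` of the element `a(x)_{(α,n)} b(x)` applied to `w`.  (Defined using a choice of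
polynomial from quasi compatibility; by the general theory the value does not depend
on the choice.) -/
def rawYE (α : ℂ) (a b : EW W) (n : ℤ) (w : W) (m : ℤ) : W :=
  if h : QCPair a b then fullYE α h.choose a b w (-n - 1) (-m - 1) else 0

/-- `a(x)_{(α,n)} b(x)`, as an element of `ℰ(W)` whenever the raw family is realized
by one (which is the case for any quasi compatible pair). -/
def YEa (α : ℂˣ) (a b : EW W) (n : ℤ) : EW W :=
  if h : ∃ c : EW W, ∀ w m, mf c w m = rawYE (α : ℂ) a b n w m then h.choose else 0

/-- `a(x)_n b(x) = a(x)_{(1,n)} b(x)`. -/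
def YE (a b : EW W) (n : ℤ) : EW W := YEa 1 a b n

end NVA

namespace NVA

variable {W : Type*} [AddCommGroup W] [Module ℂ W]

/-- Submodules of `ℰ(W)` are `ℂ`-vector spaces (registered explicitly to assist
instance resolution). -/
noncomputable instance (V : Submodule ℂ (EW W)) : AddCommGroup ↥V :=
  @Submodule.addCommGroup ℂ (EW W) _ inferInstance inferInstance V

noncomputable instance (V : Submodule ℂ (EW W)) : Module ℂ ↥V :=
  @Submodule.module ℂ (EW W) _ inferInstance inferInstance V

/-! ### Derivative and scaling operators on ℰ(W) -/

/-- `D = d/dx` on `ℰ(W)`: `(Da)_m = -m • a_{m-1}`. -/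
def Dop (a : EW W) : EW W :=
  ⟨{ toFun := fun w m => (-m : ℂ) • mf a w (m - 1)
     map_add' := by intro w w'; funext m; simp [mf, map_add]
     map_smul' := by
       intro c w; funext m
       simp only [mf, map_smul, Pi.smul_apply, RingHom.id_apply]
       exact smul_comm _ _ _ },
   by
     intro w
     obtain ⟨N, hN⟩ := a.2 w
     exact ⟨N + 1, fun m hm => by
       have : (a : W →ₗ[ℂ] (ℤ → W)) w (m - 1) = 0 := hN _ (by omega)
       simp [mf, this]⟩⟩

/-- `R_α : a(x) ↦ a(αx)`, on modes `(R_α a)_m = α^{-m-1} a_m`. -/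
def RaE (α : ℂˣ) (a : EW W) : EW W :=
  ⟨{ toFun := fun w m => ((α : ℂ) ^ (-m - 1 : ℤ)) • mf a w m
     map_add' := by intro w w'; funext m; simp [mf, map_add]
     map_smul' := by
       intro c w; funext m
       simp only [mf, map_smul, Pi.smul_apply, RingHom.id_apply]
       exact smul_comm _ _ _ },
   by
     intro w
     obtain ⟨N, hN⟩ := a.2 w
     exact ⟨N, fun m hm => by simp [mf, hN m hm]⟩⟩

/-! ### Nonlocal vertex algebras, modules and quasi modules -/

/-- The coefficient of `x₀^a x₂^b` in `Y₁(u, x₀+x₂) (Y₂(v,x₂) w)`, where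
`(x₀+x₂)^m` is expanded in nonnegative powers of `x₂`. -/
def prodCE {V : Type*} (Yo Yi : V → W → ℤ → W) (u v : V) (w : W) (a b : ℤ) : W :=
  ∑ᶠ m : ℤ, if a ≤ m then
    binom m (m - a).toNat • Yo u (Yi v w (-(b - (m - a)) - 1)) (-m - 1) else 0

/-- The coefficient of `x₀^a x₂^b` in `Y₂(Y₁(u,x₀)v, x₂) w`. -/
def assocCE {V : Type*} (Y1 : V → V → ℤ → V) (Y2 : V → W → ℤ → W)
    (u v : V) (w : W) (a b : ℤ) : W :=
  Y2 (Y1 u v (-a - 1)) w (-b - 1)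

/-- Multiplication of a two-variable family (in `x₀, x₂`) by `f(x₀+x₂, x₂)` for a
polynomial `f`, expanding `(x₀+x₂)^d` in nonnegative powers of `x₂`. -/
def mulSubPoly (f : MvPolynomial (Fin 2) ℂ) (A : ℤ → ℤ → W) (a b : ℤ) : W :=
  ∑ d ∈ f.support, ∑ i ∈ Finset.range (d 0 + 1),
    (MvPolynomial.coeff d f * ((d 0).choose i : ℂ)) •
      A (a - ((d 0 : ℤ) - i)) (b - i - (d 1 : ℤ))

/-- A nonlocal vertex algebra structure on a ℂ-vector space `V`:
a linear map `Y : V → ℰ(V) = Hom(V, V((x)))` and a vacuum vector `1` such that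
`Y(1,x)v = v`, `Y(v,x)1 ∈ V[[x]]` with constant term `v`, and weak associativity
holds. -/
structure NLVA (V : Type*) [AddCommGroup V] [Module ℂ V] where
  Y : V →ₗ[ℂ] EW V
  one : V
  vac : ∀ (v : V) (n : ℤ), mf (Y one) v n = if n = -1 then v else 0
  creation0 : ∀ (v : V) (n : ℤ), 0 ≤ n → mf (Y v) one n = 0
  creation1 : ∀ v : V, mf (Y v) one (-1) = v
  wassoc : ∀ u v w : V, ∃ l : ℕ, ∀ a b : ℤ,
    mulSubPoly (MvPolynomial.X 0 ^ l)
      (prodCE (fun x => mf (Y x)) (fun x => mf (Y x)) u v w) a b =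
    mulSubPoly (MvPolynomial.X 0 ^ l)
      (assocCE (fun x y n => mf (Y x) y n) (fun x => mf (Y x)) u v w) a b

/-- The mode maps of a nonlocal vertex algebra: `Yf A u v n = u_n v`. -/
def Yf {V : Type*} [AddCommGroup V] [Module ℂ V] (A : NLVA V) : V → V → ℤ → V :=
  fun u v n => mf (A.Y u) v n

/-- Mode maps of a linear map `V → ℰ(W)`. -/
def YWf {V : Type*} [AddCommGroup V] [Module ℂ V] (YW : V →ₗ[ℂ] EW W) :
    V → W → ℤ → W := fun v w n => mf (YW v) w n

/-- `(W, Y_W)` is a quasi module for the nonlocal vertex algebra `A` on `V`. -/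
def IsQuasiModule {V : Type*} [AddCommGroup V] [Module ℂ V] (A : NLVA V)
    (YW : V →ₗ[ℂ] EW W) : Prop :=
  (∀ (w : W) (n : ℤ), mf (YW A.one) w n = if n = -1 then w else 0) ∧
  ∀ (u v : V) (w : W), ∃ f : MvPolynomial (Fin 2) ℂ, f ≠ 0 ∧ ∀ a b : ℤ,
    mulSubPoly f (prodCE (YWf YW) (YWf YW) u v w) a b =
    mulSubPoly f (assocCE (Yf A) (YWf YW) u v w) a b

/-- `(W, Y_W)` is a module for the nonlocal vertex algebra `A` on `V`. -/
def IsModule {V : Type*} [AddCommGroup V] [Module ℂ V] (A : NLVA V)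
    (YW : V →ₗ[ℂ] EW W) : Prop :=
  (∀ (w : W) (n : ℤ), mf (YW A.one) w n = if n = -1 then w else 0) ∧
  ∀ (u v : V) (w : W), ∃ l : ℕ, ∀ a b : ℤ,
    mulSubPoly (MvPolynomial.X 0 ^ l) (prodCE (YWf YW) (YWf YW) u v w) a b =
    mulSubPoly (MvPolynomial.X 0 ^ l) (assocCE (Yf A) (YWf YW) u v w) a b

end NVA

namespace NVA

/-! ### Polynomials acting on formal families by shifts -/

section Action

open MvPolynomial

variable {W : Type*} [AddCommGroup W] [Module ℂ W]
  {G : Type*} [AddCommGroup G] {r : ℕ}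

/-- Multiplication of a formal family by the monomial of exponent `g`. -/
def shift (g : G) : Module.End ℂ (G → W) where
  toFun F h := F (h - g)
  map_add' _ _ := rfl
  map_smul' _ _ := rfl

/-- The exponent in `G` of the monomial `d` when the `i`-th variable has exponent `e i`. -/
def wt (e : Fin r → G) (d : Fin r →₀ ℕ) : G := ∑ i, d i • e i

lemma wt_add (e : Fin r → G) (d d' : Fin r →₀ ℕ) : wt e (d + d') = wt e d + wt e d' := by
  simp [wt, add_smul, Finset.sum_add_distrib]

/-- The action of polynomials on formal families, the `i`-th variable shifting by `e i`. -/
def act (e : Fin r → G) : MvPolynomial (Fin r) ℂ →ₐ[ℂ] Module.End ℂ (G → W) :=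
  AddMonoidAlgebra.lift ℂ (Module.End ℂ (G → W)) (Fin r →₀ ℕ)
    { toFun := fun d => shift (wt e d.toAdd)
      map_one' := by
        ext F h
        simp [shift, wt]
      map_mul' := fun d d' => by
        ext F h
        simp [shift, wt_add, sub_sub] }

lemma act_monomial (e : Fin r → G) (d : Fin r →₀ ℕ) (c : ℂ) (F : G → W) (g : G) :
    act e (monomial d c) F g = c • F (g - wt e d) := by
  have : act (W := W) e (monomial d c) = c • shift (wt e d) :=
    AddMonoidAlgebra.lift_single _ _ _
  rw [this]; rfl

lemma act_apply (e : Fin r → G) (p : MvPolynomial (Fin r) ℂ) (F : G → W) (g : G) :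
    act e p F g = ∑ d ∈ p.support, coeff d p • F (g - wt e d) := by
  have h : act (W := W) e p = ∑ d ∈ p.support, act e (monomial d (coeff d p)) := by
    rw [← map_sum, ← p.as_sum]
  rw [h, LinearMap.sum_apply, Finset.sum_apply]
  exact Finset.sum_congr rfl fun d _ => act_monomial e d _ F g

lemma act_X (e : Fin r → G) (i : Fin r) (F : G → W) (g : G) :
    act e (X i) F g = F (g - e i) := by
  rw [X, act_monomial, wt, Finset.sum_eq_single i] <;> simp +contextual [eq_comm]

lemma act_C (e : Fin r → G) (c : ℂ) (F : G → W) : act e (C c) F = c • F := by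
  have : act (W := W) e (C c) = algebraMap ℂ _ c := AlgHom.commutes _ c
  rw [this]; rfl

lemma act_mul (e : Fin r → G) (p q : MvPolynomial (Fin r) ℂ) (F : G → W) :
    act e (p * q) F = act e p (act e q F) := by rw [map_mul]; rfl

lemma act_add (e : Fin r → G) (p q : MvPolynomial (Fin r) ℂ) (F : G → W) :
    act e (p + q) F = act e p F + act e q F := by rw [map_add]; rfl

lemma act_comm (e : Fin r → G) (p q : MvPolynomial (Fin r) ℂ) (F : G → W) :
    act e p (act e q F) = act e q (act e p F) := by
  rw [← act_mul, mul_comm, act_mul]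

lemma act_comp {W' : Type*} [AddCommGroup W'] [Module ℂ W'] (e : Fin r → G)
    (p : MvPolynomial (Fin r) ℂ) (φ : W →ₗ[ℂ] W') (F : G → W) :
    act e p (fun g => φ (F g)) = fun g => φ (act e p F g) := by
  funext g; simp [act_apply]

/-- A subspace stable under the variables is stable under all polynomials. -/
lemma act_mem (e : Fin r → G) (S : Submodule ℂ (G → W))
    (hS : ∀ i, ∀ F ∈ S, act e (X i) F ∈ S) (p : MvPolynomial (Fin r) ℂ) :
    ∀ F ∈ S, act e p F ∈ S := by
  induction p using MvPolynomial.induction_on with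
  | C c => intro F hF; rw [act_C]; exact S.smul_mem _ hF
  | add p q hp hq => intro F hF; rw [act_add]; exact S.add_mem (hp F hF) (hq F hF)
  | mul_X p i hp => intro F hF; rw [act_mul]; exact hp _ (hS i F hF)

/-- A relation between families which is linear and turns the `i`-th variable into the
polynomial `θ i` is semilinear for the substitution `θ`. -/
structure IsSemilinear {W' G' : Type*} [AddCommGroup W'] [Module ℂ W'] [AddCommGroup G']
    {r' : ℕ} (e : Fin r → G) (e' : Fin r' → G') (θ : Fin r → MvPolynomial (Fin r') ℂ)
    (R : (G → W) → (G' → W') → Prop) : Prop where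
  add : ∀ {Q Q' E E'}, R Q E → R Q' E' → R (Q + Q') (E + E')
  smul : ∀ (c : ℂ) {Q E}, R Q E → R (c • Q) (c • E)
  var : ∀ i {Q E}, R Q E → R (act e (X i) Q) (act e' (θ i) E)

lemma IsSemilinear.act {W' G' : Type*} [AddCommGroup W'] [Module ℂ W'] [AddCommGroup G']
    {r' : ℕ} {e : Fin r → G} {e' : Fin r' → G'} {θ : Fin r → MvPolynomial (Fin r') ℂ}
    {R : (G → W) → (G' → W') → Prop} (hR : IsSemilinear e e' θ R)
    (p : MvPolynomial (Fin r) ℂ) :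
    ∀ {Q E}, R Q E → R (NVA.act e p Q) (NVA.act e' (aeval θ p) E) := by
  induction p using MvPolynomial.induction_on with
  | C c =>
    intro Q E h
    rw [aeval_C, MvPolynomial.algebraMap_eq, act_C, act_C]
    exact hR.smul c h
  | add p q hp hq => intro Q E h; rw [map_add (aeval θ), act_add, act_add]; exact hR.add (hp h) (hq h)
  | mul_X p i hp =>
    intro Q E h
    rw [map_mul (aeval θ), act_mul, act_mul, aeval_X]
    exact hp (hR.var i h)

/-- Leading term argument: if `p • F` vanishes on a translate of `B`, then so does `F` on `B`,
provided that `p` has a least exponent and `B` is stable under passing to lower exponents. -/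
lemma act_vanish {Γ : Type*} [AddCommGroup Γ] [LinearOrder Γ] [IsOrderedAddMonoid Γ]
    (e : Fin r → G) (κ : G →+ Γ) (hκ : Function.Injective fun d => κ (wt e d))
    (p : MvPolynomial (Fin r) ℂ) (d₀ : Fin r →₀ ℕ) (hd₀ : d₀ ∈ p.support)
    (hmin : ∀ d ∈ p.support, κ (wt e d₀) ≤ κ (wt e d))
    (B : Set G) (hB : ∀ g ∈ B, ∀ d ∈ p.support, g + wt e d₀ - wt e d ∈ B)
    (F : G → W)
    (hF : ∀ S : Set G, (∀ g ∈ S, F g ≠ 0) → S.Nonempty → ∃ m ∈ S, ∀ s ∈ S, κ m ≤ κ s)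
    (h0 : ∀ g ∈ B, act e p F (g + wt e d₀) = 0) : ∀ g ∈ B, F g = 0 := by
  by_contra! hcon
  obtain ⟨g₁, hg₁, hg₁'⟩ := hcon
  obtain ⟨m, ⟨hmB, hm⟩, hmm⟩ := hF {g | g ∈ B ∧ F g ≠ 0} (fun g hg => hg.2) ⟨g₁, hg₁, hg₁'⟩
  have h := h0 m hmB
  rw [act_apply, Finset.sum_eq_single_of_mem d₀ hd₀, add_sub_cancel_right] at h
  · rcases smul_eq_zero.1 h with h | h
    · exact (mem_support_iff.1 hd₀) h
    · exact hm h
  · intro d hd hne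
    by_contra hh
    have h1 := hmm (m + wt e d₀ - wt e d) ⟨hB m hmB d hd, fun h => hh (by rw [h, smul_zero])⟩
    have h2 := hmin d hd
    have h3 : κ (wt e d₀) ≠ κ (wt e d) := fun h => hne (hκ h.symm)
    rw [map_sub, map_add, add_sub_assoc, le_add_iff_nonneg_right, sub_nonneg] at h1
    exact h3 (le_antisymm h2 h1)

end Action

/-! ### Lexicographic leading terms -/

section Lex

open MvPolynomial

variable {W : Type*} [AddCommGroup W] [Module ℂ W] {G : Type*} [AddCommGroup G]

/-- Three integer coordinates, ordered lexicographically. -/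
def lexHom (c₁ c₂ c₃ : G →+ ℤ) : G →+ ℤ ×ₗ (ℤ ×ₗ ℤ) where
  toFun g := toLex (c₁ g, toLex (c₂ g, c₃ g))
  map_zero' := by simp
  map_add' g h := by simp; rfl

lemma lexHom_le (c₁ c₂ c₃ : G →+ ℤ) (g h : G) : lexHom c₁ c₂ c₃ g ≤ lexHom c₁ c₂ c₃ h ↔
    c₁ g < c₁ h ∨ c₁ g = c₁ h ∧ (c₂ g < c₂ h ∨ c₂ g = c₂ h ∧ c₃ g ≤ c₃ h) := by
  simp [lexHom, Prod.Lex.le_iff]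

lemma lexHom_injective (c₁ c₂ c₃ : G →+ ℤ) (g h : G)
    (heq : lexHom c₁ c₂ c₃ g = lexHom c₁ c₂ c₃ h) : c₁ g = c₁ h ∧ c₂ g = c₂ h ∧ c₃ g = c₃ h := by
  simpa [lexHom] using heq

/-- A family is lexicographically lower truncated with respect to three coordinates. -/
def IsLexTrunc (c₁ c₂ c₃ : G →+ ℤ) (F : G → W) : Prop :=
  (∃ j, ∀ g, c₁ g < j → F g = 0) ∧ (∀ i, ∃ j, ∀ g, c₁ g = i → c₂ g < j → F g = 0) ∧
    ∀ i i', ∃ j, ∀ g, c₁ g = i → c₂ g = i' → c₃ g < j → F g = 0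

omit [Module ℂ W] in
lemma IsLexTrunc.exists_min {c₁ c₂ c₃ : G →+ ℤ} {F : G → W} (hF : IsLexTrunc c₁ c₂ c₃ F)
    (S : Set G) (hS : ∀ g ∈ S, F g ≠ 0) (hne : S.Nonempty) :
    ∃ m ∈ S, ∀ s ∈ S, lexHom c₁ c₂ c₃ m ≤ lexHom c₁ c₂ c₃ s := by
  obtain ⟨⟨j₁, h₁⟩, h₂, h₃⟩ := hF
  obtain ⟨g₀, hg₀⟩ := hne
  obtain ⟨m₁, ⟨g₁, hg₁, e₁⟩, hm₁⟩ := Int.exists_least_of_bdd (P := fun n => ∃ g ∈ S, c₁ g = n)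
    ⟨j₁, fun n ⟨g, hg, e⟩ => not_lt.1 fun h => hS g hg (h₁ g (e ▸ h))⟩ ⟨_, g₀, hg₀, rfl⟩
  obtain ⟨j₂, h₂⟩ := h₂ m₁
  obtain ⟨m₂, ⟨g₂, hg₂, e₂, e₂'⟩, hm₂⟩ := Int.exists_least_of_bdd
    (P := fun n => ∃ g ∈ S, c₁ g = m₁ ∧ c₂ g = n)
    ⟨j₂, fun n ⟨g, hg, e, e'⟩ => not_lt.1 fun h => hS g hg (h₂ g e (e' ▸ h))⟩ ⟨_, g₁, hg₁, e₁, rfl⟩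
  obtain ⟨j₃, h₃⟩ := h₃ m₁ m₂
  obtain ⟨m₃, ⟨g₃, hg₃, e₃, e₃', e₃''⟩, hm₃⟩ := Int.exists_least_of_bdd
    (P := fun n => ∃ g ∈ S, c₁ g = m₁ ∧ c₂ g = m₂ ∧ c₃ g = n)
    ⟨j₃, fun n ⟨g, hg, e, e', e''⟩ => not_lt.1 fun h => hS g hg (h₃ g e e' (e'' ▸ h))⟩
    ⟨_, g₂, hg₂, e₂, e₂', rfl⟩
  refine ⟨g₃, hg₃, fun s hs => (lexHom_le _ _ _ _ _).2 ?_⟩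
  rw [e₃, e₃', e₃'']
  rcases (hm₁ _ ⟨s, hs, rfl⟩).lt_or_eq with h | h
  · exact Or.inl h
  rcases (hm₂ _ ⟨s, hs, h.symm, rfl⟩).lt_or_eq with h' | h'
  · exact Or.inr ⟨h, Or.inl h'⟩
  exact Or.inr ⟨h, Or.inr ⟨h', hm₃ _ ⟨s, hs, h.symm, h'.symm, rfl⟩⟩⟩

/-- Lexicographically lower truncated families form a subspace. -/
def lexTrunc (W : Type*) [AddCommGroup W] [Module ℂ W] (c₁ c₂ c₃ : G →+ ℤ) :
    Submodule ℂ (G → W) where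
  carrier := {F | IsLexTrunc c₁ c₂ c₃ F}
  zero_mem' := ⟨⟨0, fun _ _ => rfl⟩, fun _ => ⟨0, fun _ _ _ => rfl⟩,
    fun _ _ => ⟨0, fun _ _ _ _ => rfl⟩⟩
  add_mem' := by
    rintro F F' ⟨⟨j₁, h₁⟩, h₂, h₃⟩ ⟨⟨j₁', h₁'⟩, h₂', h₃'⟩
    refine ⟨⟨min j₁ j₁', fun g hg => ?_⟩, fun i => ?_, fun i i' => ?_⟩
    · rw [Pi.add_apply, h₁ g (by omega), h₁' g (by omega), add_zero]
    · obtain ⟨j, h⟩ := h₂ i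
      obtain ⟨j', h'⟩ := h₂' i
      exact ⟨min j j', fun g hi hg => by
        rw [Pi.add_apply, h g hi (by omega), h' g hi (by omega), add_zero]⟩
    · obtain ⟨j, h⟩ := h₃ i i'
      obtain ⟨j', h'⟩ := h₃' i i'
      exact ⟨min j j', fun g hi hi' hg => by
        rw [Pi.add_apply, h g hi hi' (by omega), h' g hi hi' (by omega), add_zero]⟩
  smul_mem' := by
    rintro c F ⟨⟨j₁, h₁⟩, h₂, h₃⟩
    refine ⟨⟨j₁, fun g hg => ?_⟩, fun i => ?_, fun i i' => ?_⟩
    · rw [Pi.smul_apply, h₁ g hg, smul_zero]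
    · obtain ⟨j, h⟩ := h₂ i
      exact ⟨j, fun g hi hg => by rw [Pi.smul_apply, h g hi hg, smul_zero]⟩
    · obtain ⟨j, h⟩ := h₃ i i'
      exact ⟨j, fun g hi hi' hg => by rw [Pi.smul_apply, h g hi hi' hg, smul_zero]⟩

lemma lexTrunc_act {r : ℕ} {c₁ c₂ c₃ : G →+ ℤ} (e : Fin r → G) (p : MvPolynomial (Fin r) ℂ)
    {F : G → W} (hF : F ∈ lexTrunc W c₁ c₂ c₃) : act e p F ∈ lexTrunc W c₁ c₂ c₃ := by
  refine act_mem e _ (fun i F hF => ?_) p F hF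
  obtain ⟨⟨j₁, h₁⟩, h₂, h₃⟩ := hF
  refine ⟨⟨j₁ + c₁ (e i), fun g hg => ?_⟩, fun k => ?_, fun k k' => ?_⟩
  · rw [act_X]
    exact h₁ _ (by rw [map_sub]; omega)
  · obtain ⟨j, h⟩ := h₂ (k - c₁ (e i))
    exact ⟨j + c₂ (e i), fun g hi hg => by
      rw [act_X]
      exact h _ (by rw [map_sub]; omega) (by rw [map_sub]; omega)⟩
  · obtain ⟨j, h⟩ := h₃ (k - c₁ (e i)) (k' - c₂ (e i))
    exact ⟨j + c₃ (e i), fun g hi hi' hg => by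
      rw [act_X]
      exact h _ (by rw [map_sub]; omega) (by rw [map_sub]; omega) (by rw [map_sub]; omega)⟩

/-- Nonzero polynomials act injectively on lexicographically lower truncated families. -/
lemma eq_zero_of_act_eq_zero {r : ℕ} {c₁ c₂ c₃ : G →+ ℤ} (e : Fin r → G)
    (he : Function.Injective fun d => lexHom c₁ c₂ c₃ (wt e d))
    {p : MvPolynomial (Fin r) ℂ} (hp : p ≠ 0) {F : G → W} (hF : F ∈ lexTrunc W c₁ c₂ c₃)
    (h : act e p F = 0) : F = 0 := by
  obtain ⟨d₀, hd₀, hmin⟩ := Finset.exists_min_image p.support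
    (fun d => lexHom c₁ c₂ c₃ (wt e d)) (by simpa [Finset.nonempty_iff_ne_empty] using hp)
  funext g
  exact act_vanish e _ he p d₀ hd₀ hmin Set.univ (fun _ _ _ _ => trivial) F hF.exists_min
    (fun g _ => by rw [h]; rfl) g trivial

lemma act_cancel {r : ℕ} {c₁ c₂ c₃ : G →+ ℤ} (e : Fin r → G)
    (he : Function.Injective fun d => lexHom c₁ c₂ c₃ (wt e d))
    {p : MvPolynomial (Fin r) ℂ} (hp : p ≠ 0) {F F' : G → W} (hF : F ∈ lexTrunc W c₁ c₂ c₃)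
    (hF' : F' ∈ lexTrunc W c₁ c₂ c₃) (h : act e p F = act e p F') : F = F' :=
  sub_eq_zero.1 (eq_zero_of_act_eq_zero e he hp (Submodule.sub_mem _ hF hF')
    (by rw [map_sub, h, sub_self]))

end Lex

/-! ### Substitutions in two-variable families -/

section Substitution

open MvPolynomial

variable {W : Type*} [AddCommGroup W] [Module ℂ W]

/-- Exponents of the two variables of a two-variable family. -/
def e₂ : Fin 2 → ℤ × ℤ := ![(1, 0), (0, 1)]

lemma wt_e₂ (d : Fin 2 →₀ ℕ) : wt e₂ d = ((d 0 : ℤ), (d 1 : ℤ)) := by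
  simp [wt, e₂, Fin.sum_univ_two, Prod.ext_iff]

/-- `W((x))((x₀))`, as families in `(x₀, x)`. -/
def iter₂ (W : Type*) [AddCommGroup W] [Module ℂ W] : Submodule ℂ (ℤ × ℤ → W) :=
  lexTrunc W (AddMonoidHom.fst ℤ ℤ) (AddMonoidHom.snd ℤ ℤ) 0

lemma mem_iter₂ {E : ℤ × ℤ → W} : E ∈ iter₂ W ↔
    (∃ j₀, ∀ j t, j < j₀ → E (j, t) = 0) ∧ ∀ j, ∃ t₀, ∀ t, t < t₀ → E (j, t) = 0 := by
  constructor
  · rintro ⟨⟨j₁, h₁⟩, h₂, -⟩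
    refine ⟨⟨j₁, fun j t => h₁ (j, t)⟩, fun j => ?_⟩
    obtain ⟨t₀, h⟩ := h₂ j
    exact ⟨t₀, fun t => h (j, t) rfl⟩
  · rintro ⟨⟨j₁, h₁⟩, h₂⟩
    refine ⟨⟨j₁, fun g => h₁ _ _⟩, fun j => ?_, fun _ _ => ⟨0, fun g _ _ h => absurd h (by simp)⟩⟩
    obtain ⟨t₀, h⟩ := h₂ j
    exact ⟨t₀, by rintro ⟨a, b⟩ rfl hb; exact h b hb⟩

lemma iter₂_cancel {p : MvPolynomial (Fin 2) ℂ} (hp : p ≠ 0) {F F' : ℤ × ℤ → W}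
    (hF : F ∈ iter₂ W) (hF' : F' ∈ iter₂ W) (h : act e₂ p F = act e₂ p F') : F = F' := by
  refine act_cancel e₂ (fun d d' hd => ?_) hp hF hF' h
  obtain ⟨h0, h1, -⟩ := lexHom_injective _ _ _ _ _ hd
  simp only [wt_e₂, AddMonoidHom.coe_fst, AddMonoidHom.coe_snd, Nat.cast_inj] at h0 h1
  ext i; fin_cases i <;> assumption

/-- `W((x₁, x₂))`. -/
def laur₂ (W : Type*) [AddCommGroup W] [Module ℂ W] : Submodule ℂ (ℤ × ℤ → W) where
  carrier := {Q | ∃ N : ℤ, ∀ m t, m < N ∨ t < N → Q (m, t) = 0}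
  zero_mem' := ⟨0, fun _ _ _ => rfl⟩
  add_mem' := by
    rintro Q Q' ⟨N, h⟩ ⟨N', h'⟩
    exact ⟨min N N', fun m t hmt => by
      rw [Pi.add_apply, h m t (by omega), h' m t (by omega), add_zero]⟩
  smul_mem' := by
    rintro c Q ⟨N, h⟩
    exact ⟨N, fun m t hmt => by rw [Pi.smul_apply, h m t hmt, smul_zero]⟩

lemma laur₂_act (p : MvPolynomial (Fin 2) ℂ) {Q : ℤ × ℤ → W} (hQ : Q ∈ laur₂ W) :
    act e₂ p Q ∈ laur₂ W := by
  refine act_mem e₂ _ (fun i Q hQ => ?_) p Q hQ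
  obtain ⟨N, h⟩ := hQ
  refine ⟨N, fun m t hmt => ?_⟩
  rw [act_X]
  fin_cases i
  · have h' : Q (m - 1, t) = 0 := h _ _ (by omega)
    simpa [e₂] using h'
  · have h' : Q (m, t - 1) = 0 := h _ _ (by omega)
    simpa [e₂] using h'

/-- The substitution `x₁^m ↦ ∑_j c m j • y^j x^(m-j)` on families in `(x₁, x)`. -/
def subst (c : ℤ → ℤ → ℂ) (Q : ℤ × ℤ → W) (g : ℤ × ℤ) : W :=
  ∑ᶠ m : ℤ, c m g.1 • Q (m, g.2 - m + g.1)

/-- All sums in `subst c Q` are finite. -/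
def Substitutable (c : ℤ → ℤ → ℂ) (Q : ℤ × ℤ → W) : Prop :=
  ∀ j t : ℤ, (Function.support fun m : ℤ => c m j • Q (m, t - m + j)).Finite

/-- The images of the two variables under the substitution `x₁ = y + x`. -/
def θ₂ : Fin 2 → MvPolynomial (Fin 2) ℂ := ![X 0 + X 1, X 1]

lemma subst_isSemilinear {c : ℤ → ℤ → ℂ} (hc : ∀ m j, c (m + 1) j = c m (j - 1) + c m j) :
    IsSemilinear e₂ e₂ θ₂
      (fun Q E : ℤ × ℤ → W => Substitutable c Q ∧ E = subst c Q) where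
  add := by
    rintro Q Q' E E' ⟨hQ, rfl⟩ ⟨hQ', rfl⟩
    constructor
    · intro j t
      refine ((hQ j t).union (hQ' j t)).subset fun m hm => ?_
      by_contra hh
      simp only [Set.mem_union, Function.mem_support, not_or, not_not] at hh
      exact hm (by simp only [Pi.add_apply, smul_add, hh.1, hh.2, add_zero])
    · funext g
      simp only [subst, Pi.add_apply, smul_add]
      rw [finsum_add_distrib (hQ _ _) (hQ' _ _)]
  smul := by
    rintro a Q E ⟨hQ, rfl⟩
    constructor
    · intro j t
      refine (hQ j t).subset fun m hm hh => hm ?_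
      simp only [Pi.smul_apply] at hh ⊢
      rw [smul_comm, hh, smul_zero]
    · funext g
      simp only [subst, Pi.smul_apply]
      rw [smul_finsum]
      simp only [smul_comm a]
  var := by
    rintro i Q E ⟨hQ, rfl⟩
    have key : ∀ j t m : ℤ, c (m + 1) j • Q (m, t - (m + 1) + j) =
        c m (j - 1) • Q (m, t - m + (j - 1)) + c m j • Q (m, (t - 1) - m + j) := by
      intro j t m
      rw [hc, add_smul]
      congr 4 <;> ring
    fin_cases i
    · constructor
      · intro j t
        have h := (((hQ (j - 1) t).union (hQ j (t - 1))).image (· + 1))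
        refine h.subset fun m hm => ⟨m - 1, ?_, by simp⟩
        by_contra hh
        simp only [Set.mem_union, Function.mem_support, not_or, not_not] at hh
        refine hm ?_
        have := key j t (m - 1)
        rw [hh.1, hh.2, add_zero, sub_add_cancel] at this
        simpa [act_X, e₂] using this
      · funext g
        obtain ⟨j, t⟩ := g
        have h1 : subst c (act e₂ (X 0) Q) (j, t) =
            ∑ᶠ m : ℤ, c (m + 1) j • Q (m, t - (m + 1) + j) := by
          rw [subst, ← finsum_comp_equiv (Equiv.addRight (1 : ℤ))]
          simp [act_X, e₂]
        change act e₂ (X 0 + X 1) (subst c Q) (j, t) = subst c (act e₂ (X 0) Q) (j, t)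
        rw [h1, finsum_congr (key j t), finsum_add_distrib (hQ _ _) (hQ _ _), act_add,
          Pi.add_apply, act_X, act_X]
        simp [e₂, subst]
    · have key : ∀ j t m : ℤ, c m j • act e₂ (X 1) Q (m, t - m + j) =
          c m j • Q (m, (t - 1) - m + j) := by
        intro j t m
        rw [act_X]
        congr 2
        ext <;> simp [e₂]
        ring
      constructor
      · intro j t
        have := hQ j (t - 1)
        simp only [← key] at this
        exact this
      · funext g
        obtain ⟨j, t⟩ := g
        change act e₂ (X 1) (subst c Q) (j, t) = subst c (act e₂ (X 1) Q) (j, t)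
        rw [act_X, subst, subst, finsum_congr (key j t)]
        simp [e₂]

lemma subst_comp {W' : Type*} [AddCommGroup W'] [Module ℂ W'] {c : ℤ → ℤ → ℂ}
    {Q : ℤ × ℤ → W} (hQ : Substitutable c Q) (φ : W →ₗ[ℂ] W') :
    subst c (fun g => φ (Q g)) = fun g => φ (subst c Q g) := by
  funext g
  rw [subst, subst, ← LinearMap.toAddMonoidHom_coe, AddMonoidHom.map_finsum _ (hQ _ _)]
  simp

/-- The binomial coefficient with integral lower index, extended by zero. -/
def ch (m j : ℤ) : ℂ := if 0 ≤ j then binom m j.toNat else 0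

lemma binom_zero (m : ℤ) : binom m 0 = 1 := by simp [binom]

lemma binom_succ (m : ℤ) (j : ℕ) :
    binom (m + 1) (j + 1) = binom m j + binom m (j + 1) := by
  have h : ∀ m : ℤ, ∀ j : ℕ, ∏ i ∈ Finset.range (j + 1), (((m + 1 : ℤ) : ℂ) - (i : ℂ)) =
      (m + 1) * ∏ i ∈ Finset.range j, ((m : ℂ) - (i : ℂ)) := by
    intro m j
    rw [Finset.prod_range_succ']
    push_cast
    simp [mul_comm]
  have hj : ((j + 1 : ℕ) : ℂ) ≠ 0 := by exact_mod_cast j.succ_ne_zero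
  have hf : (j.factorial : ℂ) ≠ 0 := by exact_mod_cast j.factorial_ne_zero
  rw [binom, binom, binom, h, Finset.prod_range_succ, Nat.factorial_succ]
  push_cast at hj ⊢
  field_simp
  ring

lemma binom_zero_succ (j : ℕ) : binom 0 (j + 1) = 0 := by
  rw [binom, Finset.prod_range_succ']; simp

lemma binom_natCast (n j : ℕ) : binom n j = (n.choose j : ℂ) := by
  induction n generalizing j with
  | zero => cases j with
    | zero => simp [binom_zero]
    | succ j => simpa using binom_zero_succ j
  | succ n ih => cases j with
    | zero => simp [binom_zero]
    | succ j => push_cast; rw [binom_succ, ih, ih, Nat.choose_succ_succ]; push_cast; rfl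

lemma ch_of_neg (m : ℤ) {j : ℤ} (h : j < 0) : ch m j = 0 := if_neg (by omega)

lemma ch_natCast (m : ℤ) (j : ℕ) : ch m j = binom m j := by simp [ch]

lemma ch_succ (m j : ℤ) : ch (m + 1) j = ch m (j - 1) + ch m j := by
  rcases lt_trichotomy j 0 with h | rfl | h
  · rw [ch_of_neg _ h, ch_of_neg _ h, ch_of_neg _ (by omega), add_zero]
  · rw [ch_of_neg m (by omega : (0 : ℤ) - 1 < 0)]
    simp [ch, binom_zero]
  · obtain ⟨n, rfl⟩ : ∃ n : ℕ, j = ((n + 1 : ℕ) : ℤ) := ⟨(j - 1).toNat, by omega⟩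
    rw [ch_natCast, ch_natCast, binom_succ]
    simp [ch]

lemma ch_of_lt {m j : ℤ} (h0 : 0 ≤ m) (h : m < j) : ch m j = 0 := by
  lift m to ℕ using h0
  lift j to ℕ using by omega
  rw [ch_natCast, binom_natCast, Nat.choose_eq_zero_of_lt (by omega), Nat.cast_zero]

lemma ch_symm {m : ℤ} (h0 : 0 ≤ m) (j : ℤ) : ch m (m - j) = ch m j := by
  rcases lt_or_ge j 0 with h | h
  · rw [ch_of_neg _ h, ch_of_lt h0 (by omega)]
  rcases lt_or_ge m j with h' | h'
  · rw [ch_of_lt h0 h', ch_of_neg _ (by omega)]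
  lift m to ℕ using h0
  lift j to ℕ using h
  rw [← Nat.cast_sub (by omega), ch_natCast, ch_natCast, binom_natCast, binom_natCast,
    Nat.choose_symm (by omega)]

/-- The substitution `x₁ = y + x` expanded in nonnegative powers of `y`. -/
abbrev sig (Q : ℤ × ℤ → W) : ℤ × ℤ → W := subst ch Q

/-- The coefficients of `(y + x)^m` expanded in nonnegative powers of `x`. -/
def ch' (m j : ℤ) : ℂ := ch m (m - j)

/-- The substitution `x₁ = y + x` expanded in nonnegative powers of `x`. -/
abbrev psi (Q : ℤ × ℤ → W) : ℤ × ℤ → W := subst ch' Q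

lemma ch'_succ (m j : ℤ) : ch' (m + 1) j = ch' m (j - 1) + ch' m j := by
  rw [ch', ch', ch', ch_succ, add_comm]
  congr 2 <;> ring

lemma psi_eq_sig {Q : ℤ × ℤ → W} (hQ : ∀ m t, m < 0 → Q (m, t) = 0) : psi Q = sig Q := by
  funext g
  refine finsum_congr fun m => ?_
  rcases lt_or_ge m 0 with h | h
  · rw [hQ _ _ h, smul_zero, smul_zero]
  · rw [ch', ch_symm h]

lemma substitutable_sig {Q : ℤ × ℤ → W} (hQ : Q ∈ laur₂ W) : Substitutable ch Q := by
  obtain ⟨N, h⟩ := hQ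
  intro j t
  refine (Set.finite_Icc N (t + j - N)).subset fun m hm => ?_
  by_contra hh
  rw [Set.mem_Icc] at hh
  exact hm (by simp only; rw [h _ _ (by omega), smul_zero])

lemma substitutable_psi {Q : ℤ × ℤ → W} (hQ : ∃ t₀, ∀ m t, t < t₀ → Q (m, t) = 0) :
    Substitutable ch' Q := by
  obtain ⟨t₀, h⟩ := hQ
  intro j t
  refine (Set.finite_Icc j (t + j - t₀)).subset fun m hm => ?_
  by_contra hh
  rw [Set.mem_Icc] at hh
  refine hm ?_
  by_cases hj : j ≤ m
  · simp only; rw [h _ _ (by omega), smul_zero]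
  · simp only; rw [ch', ch_of_neg _ (by omega), zero_smul]

lemma sig_mem_iter₂ {Q : ℤ × ℤ → W} (hQ : Q ∈ laur₂ W) : sig Q ∈ iter₂ W := by
  obtain ⟨N, h⟩ := hQ
  refine mem_iter₂.2 ⟨⟨0, fun j t hj => ?_⟩, fun j => ⟨N + N - j, fun t ht => ?_⟩⟩
  · exact finsum_eq_zero_of_forall_eq_zero fun m => by rw [ch_of_neg _ hj, zero_smul]
  · refine finsum_eq_zero_of_forall_eq_zero fun m => ?_
    rw [h _ _ (by simp only; omega), smul_zero]

lemma sig_act (p : MvPolynomial (Fin 2) ℂ) {Q : ℤ × ℤ → W} (hQ : Q ∈ laur₂ W) :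
    sig (act e₂ p Q) = act e₂ (aeval θ₂ p) (sig Q) :=
  (((subst_isSemilinear ch_succ).act p (Q := Q) ⟨substitutable_sig hQ, rfl⟩).2).symm

end Substitution

/-! ### The substitution `x₁ = y + x` up to polynomial denominators -/

section Rel

open MvPolynomial

variable {W : Type*} [AddCommGroup W] [Module ℂ W]

lemma aeval_θ₂_ne_zero {q : MvPolynomial (Fin 2) ℂ} (hq : q ≠ 0) : aeval θ₂ q ≠ 0 := by
  intro h
  have key : (aeval (![X 0 - X 1, X 1] : Fin 2 → MvPolynomial (Fin 2) ℂ)).comp (aeval θ₂) =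
      AlgHom.id ℂ _ := by
    ext i : 1
    fin_cases i <;> simp [θ₂]
  refine hq ?_
  rw [← AlgHom.id_apply (R := ℂ) q, ← key, AlgHom.comp_apply, h, map_zero]

lemma laur₂_map {W' : Type*} [AddCommGroup W'] [Module ℂ W'] {Q : ℤ × ℤ → W} (hQ : Q ∈ laur₂ W)
    (φ : W →ₗ[ℂ] W') : (fun g => φ (Q g)) ∈ laur₂ W' := by
  obtain ⟨N, h⟩ := hQ
  exact ⟨N, fun m t hmt => by simp only [h m t hmt, map_zero]⟩

lemma iter₂_map {W' : Type*} [AddCommGroup W'] [Module ℂ W'] {E : ℤ × ℤ → W} (hE : E ∈ iter₂ W)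
    (φ : W →ₗ[ℂ] W') : (fun g => φ (E g)) ∈ iter₂ W' := by
  obtain ⟨⟨j₀, h⟩, h'⟩ := mem_iter₂.1 hE
  refine mem_iter₂.2 ⟨⟨j₀, fun j t hj => by rw [h j t hj, map_zero]⟩, fun j => ?_⟩
  obtain ⟨t₀, ht⟩ := h' j
  exact ⟨t₀, fun t htt => by rw [ht t htt, map_zero]⟩

/-- `E` is the image of `Q` under the substitution `x₁ = y + x`, where some polynomial multiple
of `Q` lies in `W((x₁, x))`. -/
def Rel (Q E : ℤ × ℤ → W) : Prop :=
  ∃ q : MvPolynomial (Fin 2) ℂ, q ≠ 0 ∧ act e₂ q Q ∈ laur₂ W ∧ E ∈ iter₂ W ∧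
    act e₂ (aeval θ₂ q) E = sig (act e₂ q Q)

lemma Rel.act_eq {Q E : ℤ × ℤ → W} (h : Rel Q E) (p : MvPolynomial (Fin 2) ℂ)
    (hp : act e₂ p Q ∈ laur₂ W) : act e₂ (aeval θ₂ p) E = sig (act e₂ p Q) := by
  obtain ⟨q, hq, hQ, hE, he⟩ := h
  refine iter₂_cancel (aeval_θ₂_ne_zero hq) (lexTrunc_act _ _ hE) (sig_mem_iter₂ hp) ?_
  rw [act_comm, he, ← sig_act _ hQ, ← sig_act _ hp, act_comm]

lemma Rel.unique {Q E E' : ℤ × ℤ → W} (h : Rel Q E) (h' : Rel Q E') : E = E' := by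
  obtain ⟨q, hq, hQ, hE, he⟩ := h
  have := h'.act_eq q hQ
  obtain ⟨-, -, -, hE', -⟩ := h'
  exact iter₂_cancel (aeval_θ₂_ne_zero hq) hE hE' (by rw [he, this])

lemma Rel.map {W' : Type*} [AddCommGroup W'] [Module ℂ W'] {Q E : ℤ × ℤ → W} (h : Rel Q E)
    (φ : W →ₗ[ℂ] W') : Rel (fun g => φ (Q g)) (fun g => φ (E g)) := by
  obtain ⟨q, hq, hQ, hE, he⟩ := h
  refine ⟨q, hq, ?_, iter₂_map hE φ, ?_⟩
  · rw [act_comp]; exact laur₂_map hQ φ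
  · rw [act_comp, act_comp, he, ← subst_comp (substitutable_sig hQ)]

lemma Rel.of_laur₂ {Q : ℤ × ℤ → W} (hQ : Q ∈ laur₂ W) : Rel Q (sig Q) :=
  ⟨1, one_ne_zero, by simpa using hQ, sig_mem_iter₂ hQ, by simp⟩

lemma rel_isSemilinear : IsSemilinear e₂ e₂ θ₂ (Rel (W := W)) where
  add := by
    rintro Q Q' E E' h h'
    obtain ⟨q, hq, hQ, hE, he⟩ := id h
    obtain ⟨q', hq', hQ', hE', he'⟩ := id h'
    have h1 : act e₂ (q * q') Q ∈ laur₂ W := by rw [mul_comm, act_mul]; exact laur₂_act _ hQ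
    have h2 : act e₂ (q * q') Q' ∈ laur₂ W := by rw [act_mul]; exact laur₂_act _ hQ'
    refine ⟨q * q', mul_ne_zero hq hq', ?_, Submodule.add_mem _ hE hE', ?_⟩
    · rw [map_add]; exact Submodule.add_mem _ h1 h2
    · have := ((subst_isSemilinear ch_succ).add ⟨substitutable_sig h1, rfl⟩
        ⟨substitutable_sig h2, rfl⟩).2
      rw [map_add, map_add, h.act_eq _ h1, h'.act_eq _ h2, this]
  smul := by
    rintro c Q E ⟨q, hq, hQ, hE, he⟩
    refine ⟨q, hq, ?_, Submodule.smul_mem _ c hE, ?_⟩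
    · rw [map_smul]; exact Submodule.smul_mem _ c hQ
    · have := ((subst_isSemilinear ch_succ).smul c ⟨substitutable_sig hQ, rfl⟩).2
      rw [map_smul, map_smul, he, this]
  var := by
    rintro i Q E ⟨q, hq, hQ, hE, he⟩
    refine ⟨q, hq, ?_, lexTrunc_act _ _ hE, ?_⟩
    · rw [act_comm]; exact laur₂_act _ hQ
    · rw [act_comm, he, act_comm, sig_act _ hQ, aeval_X]

end Rel

/-! ### Expansions of rational functions -/

section Convolution

open MvPolynomial

variable {W : Type*} [AddCommGroup W] [Module ℂ W]

/-- The product of a scalar family and a vector valued family. -/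
def conv (u : ℤ × ℤ → ℂ) (E : ℤ × ℤ → W) (g : ℤ × ℤ) : W := ∑ᶠ s, u s • E (g - s)

lemma conv_support_finite {u : ℤ × ℤ → ℂ} {E : ℤ × ℤ → W} (hu : u ∈ iter₂ ℂ) (hE : E ∈ iter₂ W)
    (g : ℤ × ℤ) : (Function.support fun s => u s • E (g - s)).Finite := by
  obtain ⟨⟨j₁, h₁⟩, h₁'⟩ := mem_iter₂.1 hu
  obtain ⟨⟨j₂, h₂⟩, h₂'⟩ := mem_iter₂.1 hE
  choose t₁ ht₁ using h₁'
  choose t₂ ht₂ using h₂'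
  obtain ⟨J, T⟩ := g
  refine ((Set.finite_Icc j₁ (J - j₂)).biUnion fun j _ => (Set.finite_singleton j).prod
    (Set.finite_Icc (t₁ j) (T - t₂ (J - j)))).subset ?_
  rintro ⟨j, t⟩ hs
  rw [Function.mem_support] at hs
  have hu := left_ne_zero_of_smul hs
  have hv := right_ne_zero_of_smul hs
  simp only [Set.mem_iUnion, Set.mem_prod, Set.mem_singleton_iff, Set.mem_Icc, exists_prop]
  exact ⟨j, ⟨not_lt.1 fun h => hu (h₁ _ _ h), by
    by_contra h; exact hv (h₂ _ _ (by simp only; omega))⟩, rfl, not_lt.1 fun h => hu (ht₁ _ _ h), by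
    by_contra h; exact hv (ht₂ _ _ (by simp only; omega))⟩

lemma conv_eq_zero {u : ℤ × ℤ → ℂ} {E : ℤ × ℤ → W} {j₁ j₂ : ℤ}
    (h₁ : ∀ j t, j < j₁ → u (j, t) = 0) (h₂ : ∀ j t, j < j₂ → E (j, t) = 0) (J T : ℤ)
    (hJ : J < j₁ + j₂) : conv u E (J, T) = 0 := by
  refine finsum_eq_zero_of_forall_eq_zero fun ⟨j, t⟩ => ?_
  rcases lt_or_ge j j₁ with h | h
  · rw [h₁ _ _ h, zero_smul]
  · rw [Prod.mk_sub_mk, h₂ _ _ (by omega), smul_zero]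

lemma conv_mem_iter₂ {u : ℤ × ℤ → ℂ} {E : ℤ × ℤ → W} (hu : u ∈ iter₂ ℂ) (hE : E ∈ iter₂ W) :
    conv u E ∈ iter₂ W := by
  obtain ⟨⟨j₁, h₁⟩, h₁'⟩ := mem_iter₂.1 hu
  obtain ⟨⟨j₂, h₂⟩, h₂'⟩ := mem_iter₂.1 hE
  choose t₁ ht₁ using h₁'
  choose t₂ ht₂ using h₂'
  refine mem_iter₂.2 ⟨⟨j₁ + j₂, conv_eq_zero h₁ h₂⟩, fun J => ?_⟩
  obtain ⟨t₀, ht₀⟩ := ((Set.finite_Icc j₁ (J - j₂)).image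
    fun j => t₁ j + t₂ (J - j)).bddBelow
  refine ⟨t₀, fun T hT => finsum_eq_zero_of_forall_eq_zero fun ⟨j, t⟩ => ?_⟩
  by_contra hs
  have hu := left_ne_zero_of_smul hs
  have hv := right_ne_zero_of_smul hs
  rw [Prod.mk_sub_mk] at hv
  have e1 : j₁ ≤ j := not_lt.1 fun h => hu (h₁ _ _ h)
  have e2 : j₂ ≤ J - j := not_lt.1 fun h => hv (h₂ _ _ h)
  have e3 : t₁ j ≤ t := not_lt.1 fun h => hu (ht₁ _ _ h)
  have e4 : t₂ (J - j) ≤ T - t := not_lt.1 fun h => hv (ht₂ _ _ h)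
  have := ht₀ ⟨j, ⟨e1, by omega⟩, rfl⟩
  simp only at this
  omega

lemma act_conv (p : MvPolynomial (Fin 2) ℂ) {u : ℤ × ℤ → ℂ} {E : ℤ × ℤ → W} (hu : u ∈ iter₂ ℂ)
    (hE : E ∈ iter₂ W) : act e₂ p (conv u E) = conv (act e₂ p u) E := by
  have key : IsSemilinear e₂ e₂ X
      (fun (u : ℤ × ℤ → ℂ) (F : ℤ × ℤ → W) => u ∈ iter₂ ℂ ∧ F = conv u E) :=
    { add := by
        rintro u u' _ _ ⟨hu, rfl⟩ ⟨hu', rfl⟩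
        refine ⟨Submodule.add_mem _ hu hu', funext fun g => ?_⟩
        simp only [conv, Pi.add_apply, add_smul]
        rw [finsum_add_distrib (conv_support_finite hu hE g) (conv_support_finite hu' hE g)]
      smul := by
        rintro c u _ ⟨hu, rfl⟩
        refine ⟨Submodule.smul_mem _ c hu, funext fun g => ?_⟩
        simp only [conv, Pi.smul_apply, smul_assoc]
        rw [smul_finsum]
      var := by
        rintro i u _ ⟨hu, rfl⟩
        refine ⟨lexTrunc_act _ _ hu, funext fun g => ?_⟩
        rw [act_X, conv, conv, eq_comm, ← finsum_comp_equiv (Equiv.addRight (e₂ i))]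
        refine finsum_congr fun s => ?_
        change act e₂ (X i) u (s + e₂ i) • E (g - (s + e₂ i)) = _
        rw [act_X]
        rw [add_sub_cancel_right, sub_sub, add_comm s] }
  have := (key.act p ⟨hu, rfl⟩).2
  rwa [aeval_X_left, AlgHom.id_apply] at this

lemma map_aeval_mul {K : Type*} [CommRing K] [Algebra ℂ K] (c : K →+ (ℤ × ℤ → ℂ)) (v : Fin 2 → K)
    (hC : ∀ r k, c (algebraMap ℂ K r * k) = r • c k)
    (hv : ∀ i k, c (v i * k) = act e₂ (X i) (c k)) (P : MvPolynomial (Fin 2) ℂ) :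
    ∀ k, c (aeval v P * k) = act e₂ P (c k) := by
  induction P using MvPolynomial.induction_on with
  | C r => intro k; rw [aeval_C, act_C, hC]
  | add p q hp hq => intro k; rw [map_add, add_mul, map_add, act_add, hp, hq]
  | mul_X p i hp => intro k; rw [map_mul (aeval v), mul_assoc, hp, act_mul, aeval_X, hv]

lemma act_map_inv {K : Type*} [Field K] [Algebra ℂ K] (c : K →+ (ℤ × ℤ → ℂ)) (v : Fin 2 → K)
    (hC : ∀ r k, c (algebraMap ℂ K r * k) = r • c k)
    (hv : ∀ i k, c (v i * k) = act e₂ (X i) (c k)) (hc : ∀ k, c k ∈ iter₂ ℂ) (hc1 : c 1 ≠ 0)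
    {P : MvPolynomial (Fin 2) ℂ} (hP : P ≠ 0) : act e₂ P (c (aeval v P)⁻¹) = c 1 := by
  have h0 : aeval v P ≠ 0 := by
    intro h
    have h1 := map_aeval_mul c v hC hv P 1
    rw [h, zero_mul, map_zero] at h1
    exact hc1 (iter₂_cancel hP (hc 1) (Submodule.zero_mem _) (by rw [map_zero, ← h1]))
  rw [← map_aeval_mul c v hC hv, mul_inv_cancel₀ h0]

/-- The coefficients of an iterated Laurent series. -/
def cf : K2 →+ (ℤ × ℤ → ℂ) where
  toFun k s := (k.coeff s.1).coeff s.2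
  map_zero' := rfl
  map_add' _ _ := rfl

lemma algebraMap_powerSeriesAlgebra {A : Type*} [CommRing A] [Algebra ℂ A] (c : ℂ) :
    @algebraMap ℂ (HahnSeries ℤ A) _ _ (HahnSeries.powerSeriesAlgebra ℤ A) c =
      HahnSeries.single 0 (algebraMap ℂ A c) :=
  (congrArg (HahnSeries.ofPowerSeries ℤ A) (MvPowerSeries.algebraMap_apply (σ := Unit))).trans
    (HahnSeries.ofPowerSeries_C _)

lemma algebraMap_K2 (c : ℂ) : @algebraMap ℂ K2 _ CommSemiring.toSemiring _ c =
    HahnSeries.single (0 : ℤ) (HahnSeries.single (0 : ℤ) c) := by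
  have h : algebraMap ℂ LC c = HahnSeries.single 0 c := algebraMap_powerSeriesAlgebra (A := ℂ) c
  rw [← h]
  exact algebraMap_powerSeriesAlgebra (A := LC) c

lemma cf_algebraMap_mul (c : ℂ) (k : K2) :
    cf (@algebraMap ℂ K2 _ CommSemiring.toSemiring _ c * k) = c • cf k := by
  rw [algebraMap_K2]
  funext s
  refine (congrArg (fun z : LC => z.coeff s.2) (HahnSeries.coeff_single_zero_mul (Γ := ℤ) (R := LC)
    (r := HahnSeries.single 0 c) (x := k) (a := s.1))).trans ?_
  exact HahnSeries.coeff_single_zero_mul (Γ := ℤ) (R := ℂ) (r := c) (x := k.coeff s.1) (a := s.2)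

lemma cf_mem_iter₂ (k : K2) : cf k ∈ iter₂ ℂ := by
  refine mem_iter₂.2 ⟨⟨k.order, fun j t hj => ?_⟩, fun j => ⟨(k.coeff j).order, fun t ht => ?_⟩⟩
  · change (k.coeff j).coeff t = 0
    rw [HahnSeries.coeff_eq_zero_of_lt_order hj, HahnSeries.coeff_zero]
  · exact HahnSeries.coeff_eq_zero_of_lt_order ht

lemma cf_var_mul (i : Fin 2) (k : K2) : cf (![xOuter, xInner] i * k) = act e₂ (X i) (cf k) := by
  funext s
  rw [act_X]
  fin_cases i
  · refine (congrArg (fun z : LC => z.coeff s.2)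
      (HahnSeries.coeff_single_mul (R := LC) (r := 1) (b := (1 : ℤ)) (x := k) (a := s.1))).trans ?_
    simp [cf, e₂]
  · refine (congrArg (fun z : LC => z.coeff s.2) (HahnSeries.coeff_single_zero_mul (R := LC)
      (r := HahnSeries.single 1 1) (x := k) (a := s.1))).trans ?_
    refine (HahnSeries.coeff_single_mul (R := ℂ)).trans ?_
    simp [cf, e₂]

lemma cf_one : cf 1 = Pi.single 0 1 := by
  funext ⟨j, t⟩
  change (HahnSeries.coeff (R := LC) 1 j).coeff t = _
  by_cases hj : j = 0 <;> by_cases ht : t = 0 <;>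
    simp [HahnSeries.coeff_one, hj, ht, Pi.single_apply]

lemma qK_eq (p : MvPolynomial (Fin 2) ℂ) :
    qK p 1 = aeval ![xOuter, xInner] (aeval θ₂ p) := by
  have h := fun {K : Type} [CommRing K] [Algebra ℂ K] (u v : K) =>
    show aeval ![u + v, v] p = aeval ![u, v] (aeval θ₂ p) by
      rw [← AlgHom.comp_apply, comp_aeval]
      congr 2
      funext i
      fin_cases i <;> simp [θ₂]
  exact h xOuter xInner

lemma act_cf_qInv {p : MvPolynomial (Fin 2) ℂ} (hp : p ≠ 0) :
    act e₂ (aeval θ₂ p) (cf (qInv p 1)) = Pi.single 0 1 := by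
  rw [qInv, qK_eq, ← cf_one]
  refine act_map_inv (K := K2) cf _ cf_algebraMap_mul cf_var_mul cf_mem_iter₂ (fun h => ?_) (aeval_θ₂_ne_zero hp)
  have := congrFun h 0
  rw [cf_one] at this
  simp at this

end Convolution

/-! ### The products `a(x)_n b(x)` -/

section Products

open MvPolynomial

variable {W : Type*} [AddCommGroup W] [Module ℂ W]

lemma EW_ext {a b : EW W} (h : ∀ w n, mf a w n = mf b w n) : a = b :=
  Subtype.ext (LinearMap.ext fun w => funext fun n => h w n)

/-- The mode `a_n` as a linear map. -/
def mode (a : EW W) (n : ℤ) : W →ₗ[ℂ] W := LinearMap.proj n ∘ₗ (a : W →ₗ[ℂ] (ℤ → W))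

lemma mode_apply (a : EW W) (n : ℤ) (w : W) : mode a n w = mf a w n := rfl

/-- The mode `a_n w` as a linear map of `a`. -/
def modeAt (w : W) (n : ℤ) : EW W →ₗ[ℂ] W where
  toFun a := mf a w n
  map_add' _ _ := rfl
  map_smul' _ _ := rfl

lemma exists_mf_eq_zero (a : EW W) (w : W) : ∃ N : ℤ, ∀ n, N ≤ n → mf a w n = 0 := a.2 w

lemma mf_oneE (w : W) (n : ℤ) : mf oneE w n = if n = -1 then w else 0 := rfl

/-- The coefficients of `a(x₁) b(x) w`. -/
def prodFam (a b : EW W) (w : W) (s : ℤ × ℤ) : W := Fab a b w s.1 s.2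

/-- The coefficients of `(Y_ℰ(a(x), y) b(x)) w` as a family in `(y, x)`. -/
def YEFam (a b : EW W) (w : W) (s : ℤ × ℤ) : W := mf (YE a b (-s.1 - 1)) w (-s.2 - 1)

lemma mulPoly_eq (p : MvPolynomial (Fin 2) ℂ) (F : ℤ → ℤ → W) (m t : ℤ) :
    mulPoly p F m t = act e₂ p (fun s => F s.1 s.2) (m, t) := by
  rw [act_apply]
  simp only [wt_e₂]
  rfl

lemma QCPair.exists_poly {a b : EW W} (h : QCPair a b) :
    h.choose ≠ 0 ∧ ∀ w, act e₂ h.choose (prodFam a b w) ∈ laur₂ W := by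
  obtain ⟨h0, h1⟩ := h.choose_spec
  refine ⟨h0, fun w => ?_⟩
  obtain ⟨N, hN⟩ := h1 w
  exact ⟨N, fun m t hmt => (mulPoly_eq _ _ _ _).symm.trans (hN m t hmt)⟩

lemma fullYE_eq (p : MvPolynomial (Fin 2) ℂ) (a b : EW W) (w : W) (J T : ℤ) :
    fullYE 1 p a b w J T =
      conv (cf (qInv p 1)) (sig (act e₂ p (prodFam a b w))) (J, T) := by
  refine finsum_congr fun s => ?_
  refine congrArg (((qInv p 1).coeff s.1).coeff s.2 • ·) ?_
  change _ = ∑ᶠ m : ℤ, ch m (J - s.1) • act e₂ p (prodFam a b w) (m, T - s.2 - m + (J - s.1))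
  split_ifs with h
  · refine finsum_congr fun m => ?_
    rw [one_zpow, mul_one, mulPoly_eq]
    simp only [ch, if_pos h, Int.toNat_of_nonneg h]
    rfl
  · refine (finsum_eq_zero_of_forall_eq_zero fun m => ?_).symm
    rw [ch_of_neg _ (by omega), zero_smul]

lemma rel_fullYE {p : MvPolynomial (Fin 2) ℂ} (hp : p ≠ 0) (a b : EW W) (w : W)
    (h : act e₂ p (prodFam a b w) ∈ laur₂ W) :
    Rel (prodFam a b w) (fun s => fullYE 1 p a b w s.1 s.2) := by
  have he : (fun s : ℤ × ℤ => fullYE 1 p a b w s.1 s.2) =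
      conv (cf (qInv p 1)) (sig (act e₂ p (prodFam a b w))) := funext fun s => fullYE_eq _ _ _ _ _ _
  rw [he]
  refine ⟨p, hp, h, conv_mem_iter₂ (cf_mem_iter₂ _) (sig_mem_iter₂ h), ?_⟩
  rw [act_conv _ (cf_mem_iter₂ _) (sig_mem_iter₂ h), act_cf_qInv hp]
  funext g
  rw [conv, finsum_eq_single _ 0 (fun s hs => by rw [Pi.single_eq_of_ne hs, zero_smul])]
  simp

lemma prodFam_add (a b : EW W) (w w' : W) :
    prodFam a b (w + w') = prodFam a b w + prodFam a b w' := by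
  funext s; simp [prodFam, Fab, ← mode_apply]

lemma prodFam_smul (a b : EW W) (c : ℂ) (w : W) :
    prodFam a b (c • w) = c • prodFam a b w := by
  funext s; simp [prodFam, Fab, ← mode_apply]

lemma YEFam_eq {a b : EW W} (h : QCPair a b) (w : W) :
    YEFam a b w = fun s => fullYE 1 h.choose a b w s.1 s.2 := by
  obtain ⟨hp, hL⟩ := h.exists_poly
  have hR := fun w => rel_fullYE hp a b w (hL w)
  have key : ∀ n, ∃ c : EW W, ∀ w m, mf c w m = rawYE ((1 : ℂˣ) : ℂ) a b n w m := by
    intro n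
    refine ⟨⟨{ toFun := fun w m => fullYE 1 h.choose a b w (-n - 1) (-m - 1)
               map_add' := fun w w' => ?_
               map_smul' := fun c w => ?_ }, fun w => ?_⟩, fun w m => ?_⟩
    · have := rel_isSemilinear.add (hR w) (hR w')
      rw [← prodFam_add] at this
      funext m
      exact congrFun ((hR (w + w')).unique this) (-n - 1, -m - 1)
    · have := rel_isSemilinear.smul c (hR w)
      rw [← prodFam_smul] at this
      funext m
      exact congrFun ((hR (c • w)).unique this) (-n - 1, -m - 1)
    · obtain ⟨-, -, -, hE, -⟩ := hR w
      obtain ⟨t₀, ht₀⟩ := (mem_iter₂.1 hE).2 (-n - 1)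
      exact ⟨-t₀, fun m hm => ht₀ (-m - 1) (by omega)⟩
    · rw [rawYE, dif_pos h]
      simp [mf]
  funext s
  rw [YEFam, YE, YEa, dif_pos (key _), (key _).choose_spec, rawYE, dif_pos h]
  simp

lemma YEFam_rel {a b : EW W} (h : QCPair a b) (w : W) : Rel (prodFam a b w) (YEFam a b w) := by
  rw [YEFam_eq h]
  obtain ⟨hp, hL⟩ := h.exists_poly
  exact rel_fullYE hp a b w (hL w)

lemma exists_YE_eq_zero {a b : EW W} (h : QCPair a b) :
    ∃ N : ℤ, ∀ n, N ≤ n → YE a b n = 0 := by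
  obtain ⟨hp, hL⟩ := h.exists_poly
  obtain ⟨⟨j₁, h₁⟩, -⟩ := mem_iter₂.1 (cf_mem_iter₂ (qInv h.choose 1))
  refine ⟨-j₁, fun n hn => EW_ext fun w m => ?_⟩
  have h1 := congrFun (YEFam_eq h w) (-n - 1, -m - 1)
  simp only [YEFam, fullYE_eq, sub_neg_eq_add, neg_sub, add_sub_cancel_left] at h1
  have h2 := h1.trans (conv_eq_zero (j₂ := 0) h₁ (fun j t hj =>
    finsum_eq_zero_of_forall_eq_zero fun m => by rw [ch_of_neg _ hj, zero_smul]) _ _ (by omega))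
  exact h2

lemma YE_unique {a b : EW W} (h : QCPair a b) (c : ℤ → EW W)
    (hc : ∀ w, Rel (prodFam a b w) (fun s => mf (c (-s.1 - 1)) w (-s.2 - 1))) (n : ℤ) :
    YE a b n = c n := by
  refine EW_ext fun w m => ?_
  have := congrFun ((YEFam_rel h w).unique (hc w)) (-n - 1, -m - 1)
  simpa [YEFam] using this

lemma YE_add_left {a a' b : EW W} (h : QCPair a b) (h' : QCPair a' b) (h'' : QCPair (a + a') b)
    (n : ℤ) : YE (a + a') b n = YE a b n + YE a' b n :=
  YE_unique h'' (fun n => YE a b n + YE a' b n)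
    (fun w => rel_isSemilinear.add (YEFam_rel h w) (YEFam_rel h' w)) n

lemma YE_smul_left {a b : EW W} (c : ℂ) (h : QCPair a b) (h' : QCPair (c • a) b)
    (n : ℤ) : YE (c • a) b n = c • YE a b n :=
  YE_unique h' (fun n => c • YE a b n)
    (fun w => rel_isSemilinear.smul c (YEFam_rel h w)) n

lemma YE_add_right {a b b' : EW W} (h : QCPair a b) (h' : QCPair a b') (h'' : QCPair a (b + b'))
    (n : ℤ) : YE a (b + b') n = YE a b n + YE a b' n := by
  refine YE_unique h'' (fun n => YE a b n + YE a b' n) (fun w => ?_) n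
  have he : prodFam a (b + b') w = prodFam a b w + prodFam a b' w :=
    funext fun s => (mode a (-s.1 - 1)).map_add (mf b w (-s.2 - 1)) (mf b' w (-s.2 - 1))
  rw [he]
  exact rel_isSemilinear.add (YEFam_rel h w) (YEFam_rel h' w)

lemma YE_smul_right {a b : EW W} (c : ℂ) (h : QCPair a b) (h' : QCPair a (c • b))
    (n : ℤ) : YE a (c • b) n = c • YE a b n := by
  refine YE_unique h' (fun n => c • YE a b n) (fun w => ?_) n
  have he : prodFam a (c • b) w = c • prodFam a b w :=
    funext fun s => (mode a (-s.1 - 1)).map_smul c (mf b w (-s.2 - 1))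
  rw [he]
  exact rel_isSemilinear.smul c (YEFam_rel h w)

lemma YE_oneE_left {b : EW W} (h : QCPair oneE b) (n : ℤ) :
    YE oneE b n = if n = -1 then b else 0 := by
  refine YE_unique h (fun n => if n = -1 then b else 0) (fun w => ?_) n
  have hQ : prodFam oneE b w ∈ laur₂ W := by
    obtain ⟨N, hN⟩ := exists_mf_eq_zero b w
    refine ⟨min 0 (-N), fun m t hmt => ?_⟩
    simp only [prodFam, Fab, mf_oneE]
    split_ifs with hm
    · exact hN _ (by omega)
    · rfl
  convert Rel.of_laur₂ hQ using 1
  funext ⟨j, t⟩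
  rw [sig, subst, finsum_eq_single _ 0]
  · simp only [prodFam, Fab, mf_oneE, neg_zero, zero_sub, if_true, sub_zero]
    rcases lt_trichotomy j 0 with hj | rfl | hj
    · rw [ch_of_neg _ hj, zero_smul, if_neg (by omega)]; rfl
    · simp [ch, binom_zero]
    · rw [ch_of_lt le_rfl hj, zero_smul, if_neg (by omega)]; rfl
  · intro m hm
    simp only [prodFam, Fab, mf_oneE]
    rw [if_neg (by omega), smul_zero]

lemma YE_oneE_right {a : EW W} (h : QCPair a oneE) :
    (∀ n, 0 ≤ n → YE a oneE n = 0) ∧ YE a oneE (-1) = a := by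
  have hQ : ∀ w, prodFam a oneE w ∈ laur₂ W := by
    intro w
    obtain ⟨N, hN⟩ := exists_mf_eq_zero a w
    refine ⟨min 0 (-N), fun m t hmt => ?_⟩
    simp only [prodFam, Fab, mf_oneE]
    split_ifs with hm
    · exact hN _ (by omega)
    · exact (mode a _).map_zero
  have key : ∀ w, YEFam a oneE w = sig (prodFam a oneE w) := fun w =>
    (YEFam_rel h w).unique (Rel.of_laur₂ (hQ w))
  constructor
  · intro n hn
    refine EW_ext fun w m => ?_
    have := congrFun (key w) (-n - 1, -m - 1)
    rw [sig, subst, finsum_eq_zero_of_forall_eq_zero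
      (fun m => by rw [ch_of_neg _ (by simp only; omega), zero_smul])] at this
    change _ = (0 : W)
    simpa [YEFam] using this
  · refine EW_ext fun w m => ?_
    have := congrFun (key w) (0, -m - 1)
    rw [sig, subst, finsum_eq_single _ (-m - 1)] at this
    · simpa [YEFam, prodFam, Fab, mf_oneE, ch, binom_zero] using this
    · intro k hk
      simp only [prodFam, Fab, mf_oneE]
      rw [if_neg (by omega), ← mode_apply, map_zero, smul_zero]

end Products

/-! ### Comparison with the formulation through coefficients -/

section Coefficients

open MvPolynomial

variable {W : Type*} [AddCommGroup W] [Module ℂ W]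

lemma pairPoly_two (p : MvPolynomial (Fin 2) ℂ) : pairPoly p 2 = p := by
  have : (Finset.univ.filter fun ij : Fin 2 × Fin 2 => ij.1 < ij.2) = {(0, 1)} := by decide
  rw [pairPoly, this, Finset.prod_singleton]
  have h : (![0, 1] : Fin 2 → Fin 2) = id := by
    funext i; fin_cases i <;> rfl
  exact (congrArg (fun f => rename f p) h).trans (rename_id_apply p)

lemma QCSeq.qcPair {a b : EW W} (h : QCSeq ![a, b]) : QCPair a b := by
  obtain ⟨p, hp, hL⟩ := h
  refine ⟨p, hp, fun w => ?_⟩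
  obtain ⟨N, hN⟩ := hL w
  refine ⟨N, fun m t hmt => ?_⟩
  rw [pairPoly_two] at hN
  exact hN ![m, t] (by simpa [Fin.exists_fin_two] using hmt)

lemma act_X_add_X_pow (n : ℕ) (F : ℤ × ℤ → W) (a b : ℤ) :
    act e₂ ((X 0 + X 1) ^ n) F (a, b) = ∑ i ∈ Finset.range (n + 1),
      (n.choose i : ℂ) • F (a - ((n : ℤ) - i), b - i) := by
  have h : ((X 0 + X 1) ^ n : MvPolynomial (Fin 2) ℂ) = ∑ i ∈ Finset.range (n + 1),
      monomial (Finsupp.single 0 (n - i) + Finsupp.single 1 i) (n.choose i : ℂ) := by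
    rw [add_comm, add_pow]
    refine Finset.sum_congr rfl fun i _ => ?_
    rw [X_pow_eq_monomial, X_pow_eq_monomial, monomial_mul, one_mul, ← C_eq_coe_nat,
      mul_comm (monomial _ _), C_mul_monomial, mul_one, add_comm]
  rw [h, map_sum, LinearMap.sum_apply, Finset.sum_apply]
  refine Finset.sum_congr rfl fun i hi => ?_
  rw [act_monomial, wt_e₂]
  have : i ≤ n := by simpa [Nat.lt_succ_iff] using hi
  simp [Nat.cast_sub this]

lemma mulSubPoly_eq (f : MvPolynomial (Fin 2) ℂ) (A : ℤ → ℤ → W) (a b : ℤ) :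
    mulSubPoly f A a b = act e₂ (aeval θ₂ f) (fun s => A s.1 s.2) (a, b) := by
  have h : aeval θ₂ f = ∑ d ∈ f.support, C (coeff d f) * (X 1 ^ d 1 * (X 0 + X 1) ^ d 0) := by
    rw [aeval_def, eval₂_eq']
    simp [Fin.prod_univ_two, θ₂, mul_comm]
  rw [h, map_sum, LinearMap.sum_apply, Finset.sum_apply]
  refine Finset.sum_congr rfl fun d _ => ?_
  have hX : ∀ F : ℤ × ℤ → W, act e₂ (X 1 ^ d 1) F (a, b) = F (a, b - (d 1 : ℤ)) := by
    intro F
    rw [X_pow_eq_monomial, act_monomial, wt_e₂]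
    simp
  rw [act_mul, act_C, Pi.smul_apply, act_mul, hX, act_X_add_X_pow, Finset.smul_sum]
  refine Finset.sum_congr rfl fun i _ => ?_
  rw [smul_smul]
  simp only
  congr 2
  ring

lemma prodCE_eq {V : Type*} (Yo Yi : V → W → ℤ → W) (u v : V) (w : W) (a b : ℤ) :
    prodCE Yo Yi u v w a b =
      psi (fun s : ℤ × ℤ => Yo u (Yi v w (-s.2 - 1)) (-s.1 - 1)) (a, b) := by
  refine finsum_congr fun m => ?_
  split_ifs with h
  · simp only [ch']
    obtain ⟨n, hn⟩ : ∃ n : ℕ, m - a = n := ⟨(m - a).toNat, by omega⟩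
    rw [hn, ch_natCast, Int.toNat_natCast]
    congr 4
    omega
  · rw [ch', ch_of_neg _ (by simp only; omega), zero_smul]

end Coefficients

/-! ### Substitutions in slices of three-variable families -/

section Slices

open MvPolynomial

variable {W : Type*} [AddCommGroup W] [Module ℂ W]

/-- Exponents of the three variables of a three-variable family. -/
def e₃ : Fin 3 → ℤ × ℤ × ℤ := ![(1, 0, 0), (0, 1, 0), (0, 0, 1)]

lemma wt_e₃ (d : Fin 3 →₀ ℕ) : wt e₃ d = ((d 0 : ℤ), (d 1 : ℤ), (d 2 : ℤ)) := by
  simp [wt, e₃, Fin.sum_univ_three, Prod.ext_iff]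

/-- The map `ρ` reads the first coordinate as the `w`-th variable and the other two coordinates as
the `u`-th and `v`-th ones, and `θ` is the substitution adding the `v`-th to the `u`-th variable. -/
structure IsSlicing (ρ : ℤ × (ℤ × ℤ) ≃+ ℤ × ℤ × ℤ) (u v w : Fin 3)
    (θ : Fin 3 → MvPolynomial (Fin 3) ℂ) : Prop where
  e_u : e₃ u = ρ (0, 1, 0)
  e_v : e₃ v = ρ (0, 0, 1)
  e_w : e₃ w = ρ (1, 0, 0)
  θ_u : θ u = X u + X v
  θ_v : θ v = X v
  θ_w : θ w = X w
  exhaust : ∀ i, i = u ∨ i = v ∨ i = w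
  nonneg : ∀ g, 0 ≤ ρ g ↔ 0 ≤ g

/-- The slice of a three-variable family at the exponent `k` of the remaining variable. -/
def slice (ρ : ℤ × (ℤ × ℤ) ≃+ ℤ × ℤ × ℤ) (k : ℤ) (D : ℤ × ℤ × ℤ → W) (s : ℤ × ℤ) : W :=
  D (ρ (k, s))

omit [AddCommGroup W] [Module ℂ W] in
/-- Families are determined by their slices. -/
lemma slice_ext {ρ : ℤ × (ℤ × ℤ) ≃+ ℤ × ℤ × ℤ} {D D' : ℤ × ℤ × ℤ → W}
    (h : ∀ k, slice ρ k D = slice ρ k D') : D = D' := by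
  funext g
  simpa [slice] using congrFun (h (ρ.symm g).1) (ρ.symm g).2

variable {ρ : ℤ × (ℤ × ℤ) ≃+ ℤ × ℤ × ℤ} {u v w : Fin 3} {θ : Fin 3 → MvPolynomial (Fin 3) ℂ}

lemma IsSlicing.slice_act_u (h : IsSlicing ρ u v w θ) (k : ℤ) (D : ℤ × ℤ × ℤ → W) :
    slice ρ k (act e₃ (X u) D) = act e₂ (X 0) (slice ρ k D) := by
  funext s
  rw [slice, act_X, act_X, h.e_u, ← map_sub]
  simp [slice, e₂]

lemma IsSlicing.slice_act_v (h : IsSlicing ρ u v w θ) (k : ℤ) (D : ℤ × ℤ × ℤ → W) :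
    slice ρ k (act e₃ (X v) D) = act e₂ (X 1) (slice ρ k D) := by
  funext s
  rw [slice, act_X, act_X, h.e_v, ← map_sub]
  simp [slice, e₂]

lemma IsSlicing.slice_act_w (h : IsSlicing ρ u v w θ) (k : ℤ) (D : ℤ × ℤ × ℤ → W) :
    slice ρ k (act e₃ (X w) D) = slice ρ (k - 1) D := by
  funext s
  rw [slice, act_X, h.e_w, ← map_sub]
  simp only [slice, Prod.mk_sub_mk, Prod.mk_zero_zero, sub_zero]

lemma IsSlicing.slice_act_rename (h : IsSlicing ρ u v w θ) (k : ℤ)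
    (p : MvPolynomial (Fin 2) ℂ) :
    ∀ D : ℤ × ℤ × ℤ → W, slice ρ k (act e₃ (rename ![u, v] p) D) = act e₂ p (slice ρ k D) := by
  induction p using MvPolynomial.induction_on with
  | C c => intro D; rw [rename_C, act_C, act_C]; rfl
  | add p q hp hq => intro D; rw [map_add (rename _), act_add, act_add, ← hp, ← hq]; rfl
  | mul_X p i hp =>
    intro D
    rw [map_mul (rename _), act_mul, act_mul, hp, rename_X]
    congr 1
    fin_cases i
    · exact h.slice_act_u k D
    · exact h.slice_act_v k D

lemma IsSlicing.isSemilinear (h : IsSlicing ρ u v w θ) {R : (ℤ × ℤ → W) → (ℤ × ℤ → W) → Prop}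
    (hR : IsSemilinear e₂ e₂ θ₂ R) :
    IsSemilinear e₃ e₃ θ (fun D E => ∀ k, R (slice ρ k D) (slice ρ k E)) where
  add hD hD' k := hR.add (hD k) (hD' k)
  smul c _ _ hD k := hR.smul c (hD k)
  var i D E hD k := by
    rcases h.exhaust i with rfl | rfl | rfl
    · have := hR.var 0 (hD k)
      rw [h.slice_act_u, h.θ_u, act_add]
      convert this using 1
      change _ = act e₂ (X 0 + X 1) _
      rw [act_add, ← h.slice_act_u, ← h.slice_act_v]
      rfl
    · rw [h.slice_act_v, h.θ_v, h.slice_act_v]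
      exact hR.var 1 (hD k)
    · rw [h.slice_act_w, h.θ_w, h.slice_act_w]
      exact hD _

/-- The substitution `subst c` in every slice. -/
def sliceSubst (ρ : ℤ × (ℤ × ℤ) ≃+ ℤ × ℤ × ℤ) (c : ℤ → ℤ → ℂ) (D : ℤ × ℤ × ℤ → W)
    (g : ℤ × ℤ × ℤ) : W :=
  subst c (slice ρ (ρ.symm g).1 D) (ρ.symm g).2

lemma slice_sliceSubst (c : ℤ → ℤ → ℂ) (D : ℤ × ℤ × ℤ → W) (k : ℤ) :
    slice ρ k (sliceSubst ρ c D) = subst c (slice ρ k D) := by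
  funext s; simp [slice, sliceSubst]

lemma IsSlicing.act_sliceSubst (h : IsSlicing ρ u v w θ) {c : ℤ → ℤ → ℂ}
    (hc : ∀ m j, c (m + 1) j = c m (j - 1) + c m j) {D : ℤ × ℤ × ℤ → W}
    (hD : ∀ k, Substitutable c (slice ρ k D)) (p : MvPolynomial (Fin 3) ℂ) :
    act e₃ (aeval θ p) (sliceSubst ρ c D) = sliceSubst ρ c (act e₃ p D) := by
  have := (h.isSemilinear (subst_isSemilinear hc)).act p (Q := D) (E := sliceSubst ρ c D)
    fun k => ⟨hD k, slice_sliceSubst c D k⟩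
  refine slice_ext (ρ := ρ) fun k => ?_
  rw [(this k).2, slice_sliceSubst]

/-- Formal power series in three variables. -/
def pow₃ (W : Type*) [AddCommGroup W] [Module ℂ W] : Submodule ℂ (ℤ × ℤ × ℤ → W) where
  carrier := {D | ∀ g, ¬ 0 ≤ g → D g = 0}
  zero_mem' _ _ := rfl
  add_mem' h h' g hg := by rw [Pi.add_apply, h g hg, h' g hg, add_zero]
  smul_mem' c _ h g hg := by rw [Pi.smul_apply, h g hg, smul_zero]

lemma pow₃_act (p : MvPolynomial (Fin 3) ℂ) {D : ℤ × ℤ × ℤ → W} (hD : D ∈ pow₃ W) :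
    act e₃ p D ∈ pow₃ W := by
  refine act_mem e₃ _ (fun i D hD g hg => ?_) p D hD
  rw [act_X]
  refine hD _ fun h => hg (h.trans (sub_le_self _ ?_))
  fin_cases i <;> simp [e₃, Prod.le_def]

lemma IsSlicing.slice_eq_zero (h : IsSlicing ρ u v w θ) {D : ℤ × ℤ × ℤ → W} (hD : D ∈ pow₃ W)
    {k m t : ℤ} (hk : k < 0 ∨ m < 0 ∨ t < 0) : slice ρ k D (m, t) = 0 :=
  hD _ fun h' => by
    have := (h.nonneg _).1 h'
    simp only [Prod.le_def, Prod.fst_zero, Prod.snd_zero] at this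
    omega

lemma IsSlicing.slice_mem_laur₂ (h : IsSlicing ρ u v w θ) {D : ℤ × ℤ × ℤ → W} (hD : D ∈ pow₃ W)
    (k : ℤ) : slice ρ k D ∈ laur₂ W :=
  ⟨0, fun _ _ hmt => h.slice_eq_zero hD (Or.inr hmt)⟩

lemma IsSlicing.sliceSubst_ch_mem (h : IsSlicing ρ u v w θ) {D : ℤ × ℤ × ℤ → W}
    (hD : D ∈ pow₃ W) : sliceSubst ρ ch D ∈ pow₃ W := by
  intro g hg
  obtain ⟨⟨k, j, t⟩, rfl⟩ := ρ.surjective g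
  rw [h.nonneg] at hg
  simp only [Prod.le_def, Prod.fst_zero, Prod.snd_zero] at hg
  rw [sliceSubst, ρ.symm_apply_apply]
  refine finsum_eq_zero_of_forall_eq_zero fun m => ?_
  simp only
  rcases lt_or_ge j 0 with hj | hj
  · rw [ch_of_neg _ hj, zero_smul]
  rcases lt_or_ge m 0 with hm | hm
  · rw [h.slice_eq_zero hD (by omega), smul_zero]
  rcases lt_or_ge m j with hmj | hmj
  · rw [ch_of_lt hm hmj, zero_smul]
  · rw [h.slice_eq_zero hD (by omega), smul_zero]

/-- In families of power series, slicewise relations are given by slicewise substitution. -/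
lemma IsSlicing.eq_sliceSubst_of_rel (h : IsSlicing ρ u v w θ) {D E : ℤ × ℤ × ℤ → W}
    (hD : ∀ k, Rel (slice ρ k D) (slice ρ k E)) (p : MvPolynomial (Fin 3) ℂ)
    (hp : act e₃ p D ∈ pow₃ W) :
    act e₃ (aeval θ p) E = sliceSubst ρ ch (act e₃ p D) := by
  refine slice_ext (ρ := ρ) fun k => ?_
  rw [slice_sliceSubst]
  exact ((h.isSemilinear rel_isSemilinear).act p hD k).unique
    (Rel.of_laur₂ (h.slice_mem_laur₂ hp k))

/-- Properties of an operator on power series that determine it. -/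
structure IsSubstOn (θ : Fin 3 → MvPolynomial (Fin 3) ℂ)
    (Φ : (ℤ × ℤ × ℤ → W) → (ℤ × ℤ × ℤ → W)) : Prop where
  mem : ∀ {D}, D ∈ pow₃ W → Φ D ∈ pow₃ W
  add : ∀ {D D'}, D ∈ pow₃ W → D' ∈ pow₃ W → Φ (D + D') = Φ D + Φ D'
  act : ∀ {D} (p : MvPolynomial (Fin 3) ℂ), D ∈ pow₃ W →
    Φ (NVA.act e₃ p D) = NVA.act e₃ (aeval θ p) (Φ D)
  const : ∀ w, Φ (Pi.single 0 w) = Pi.single 0 w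

lemma sig_single (w : W) : sig (Pi.single 0 w : ℤ × ℤ → W) = Pi.single 0 w := by
  funext ⟨j, t⟩
  rw [sig, subst, finsum_eq_single _ 0]
  · rcases lt_trichotomy j 0 with hj | rfl | hj
    · rw [ch_of_neg _ hj, zero_smul, Pi.single_eq_of_ne (by simp [Prod.ext_iff]; omega)]
    · simp [ch, binom_zero]
    · rw [ch_of_lt le_rfl hj, zero_smul, Pi.single_eq_of_ne (by simp [Prod.ext_iff]; omega)]
  · intro m hm
    rw [Pi.single_eq_of_ne (by simp [Prod.ext_iff]; omega), smul_zero]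

lemma IsSlicing.isSubstOn (h : IsSlicing ρ u v w θ) :
    IsSubstOn θ (sliceSubst (W := W) ρ ch) where
  mem := h.sliceSubst_ch_mem
  add := by
    intro D D' hD hD'
    refine slice_ext (ρ := ρ) fun k => ?_
    rw [slice_sliceSubst]
    refine (((subst_isSemilinear ch_succ).add ⟨substitutable_sig (h.slice_mem_laur₂ hD k), rfl⟩
      ⟨substitutable_sig (h.slice_mem_laur₂ hD' k), rfl⟩).2).symm.trans ?_
    rw [← slice_sliceSubst, ← slice_sliceSubst]
    rfl
  act := by
    intro D p hD
    rw [h.act_sliceSubst ch_succ fun k => substitutable_sig (h.slice_mem_laur₂ hD k)]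
  const := by
    intro w
    refine slice_ext (ρ := ρ) fun k => ?_
    rw [slice_sliceSubst]
    have hs : ∀ s, (ρ (k, s) = 0) = ((k, s) = 0) := fun s => by rw [map_eq_zero_iff _ ρ.injective]
    by_cases hk : k = 0
    · have : slice ρ k (Pi.single 0 w) = Pi.single 0 w := by
        funext s
        simp [slice, Pi.single_apply, hk]
      rw [this]
      exact sig_single w
    · have : slice ρ k (Pi.single 0 w) = 0 := by
        funext s
        simp [slice, hs, hk]
      rw [this]
      funext g
      exact finsum_eq_zero_of_forall_eq_zero fun m => smul_zero _

lemma IsSubstOn.comp {θ θ' : Fin 3 → MvPolynomial (Fin 3) ℂ}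
    {Φ Φ' : (ℤ × ℤ × ℤ → W) → (ℤ × ℤ × ℤ → W)} (h : IsSubstOn θ Φ) (h' : IsSubstOn θ' Φ') :
    IsSubstOn (fun i => aeval θ' (θ i)) (Φ' ∘ Φ) where
  mem hD := h'.mem (h.mem hD)
  add hD hD' := by
    simp only [Function.comp_apply]
    rw [h.add hD hD', h'.add (h.mem hD) (h.mem hD')]
  act p hD := by
    simp only [Function.comp_apply]
    rw [h.act p hD, h'.act _ (h.mem hD), ← comp_aeval]
    rfl
  const w := by
    simp only [Function.comp_apply]
    rw [h.const, h'.const]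

/-- A power series is the sum of its constant term and of multiples of the variables. -/
lemma exists_decomp {D : ℤ × ℤ × ℤ → W} (hD : D ∈ pow₃ W) :
    ∃ T : Fin 3 → ℤ × ℤ × ℤ → W, (∀ i, T i ∈ pow₃ W) ∧ D = Pi.single 0 (D 0) +
      (act e₃ (X 0) (T 0) + (act e₃ (X 1) (T 1) + act e₃ (X 2) (T 2))) := by
  refine ⟨![fun g => if 0 ≤ g then D (g + e₃ 0) else 0,
    fun g => if 0 ≤ g ∧ g.1 = 0 then D (g + e₃ 1) else 0,
    fun g => if 0 ≤ g ∧ g.1 = 0 ∧ g.2.1 = 0 then D (g + e₃ 2) else 0], fun i g hg => ?_, ?_⟩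
  · fin_cases i <;> simp [hg]
  · funext g
    simp only [Pi.add_apply, act_X, Matrix.cons_val, sub_add_cancel]
    by_cases hg : 0 ≤ g
    · obtain ⟨x, y, z⟩ := g
      simp only [Prod.le_def, Prod.fst_zero, Prod.snd_zero] at hg
      simp only [Pi.single_apply, Prod.le_def, Prod.ext_iff, e₃, Matrix.cons_val, Prod.fst_zero,
        Prod.snd_zero, Prod.mk_sub_mk, sub_zero]
      by_cases hx : x = 0
      · by_cases hy : y = 0
        · by_cases hz : z = 0
          · subst hx hy hz; simp; rfl
          · rw [if_neg (by omega), if_neg (by omega), if_neg (by omega), if_pos (by omega)]; simp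
        · rw [if_neg (by omega), if_neg (by omega), if_pos (by omega), if_neg (by omega)]; simp
      · rw [if_neg (by omega), if_pos (by omega), if_neg (by omega), if_neg (by omega)]; simp
    · have h : ∀ i, ¬ 0 ≤ g - e₃ i := fun i h => hg (h.trans (sub_le_self _ (by
        fin_cases i <;> simp [e₃, Prod.le_def])))
      rw [hD g hg, Pi.single_eq_of_ne (fun h => hg h.ge), if_neg (h 0), if_neg fun h' => h 1 h'.1,
        if_neg fun h' => h 2 h'.1]
      simp

/-- Operators on power series are determined by the images of the variables. -/
lemma IsSubstOn.unique {Φ Φ' : (ℤ × ℤ × ℤ → W) → (ℤ × ℤ × ℤ → W)}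
    (h : IsSubstOn ![X 0 + X 1 + X 2, X 1 + X 2, X 2] Φ)
    (h' : IsSubstOn ![X 0 + X 1 + X 2, X 1 + X 2, X 2] Φ') {D : ℤ × ℤ × ℤ → W} (hD : D ∈ pow₃ W) :
    Φ D = Φ' D := by
  have key : ∀ n : ℕ, ∀ D ∈ pow₃ W, ∀ g : ℤ × ℤ × ℤ, g.1 + g.2.1 + g.2.2 < n → Φ D g = Φ' D g := by
    intro n
    induction n with
    | zero =>
      intro D hD g hg
      have : ¬ 0 ≤ g := by
        simp only [Prod.le_def, Prod.fst_zero, Prod.snd_zero]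
        push_cast at hg
        omega
      rw [h.mem hD g this, h'.mem hD g this]
    | succ n ih =>
      intro D hD g hg
      obtain ⟨T, hT, e⟩ := exists_decomp hD
      have hX : ∀ i, NVA.act e₃ (X i) (T i) ∈ pow₃ W := fun i => pow₃_act _ (hT i)
      have hs : (Pi.single 0 (D 0) : ℤ × ℤ × ℤ → W) ∈ pow₃ W := fun g hg =>
        Pi.single_eq_of_ne (fun h => hg h.ge) _
      have h12 := Submodule.add_mem _ (hX 1) (hX 2)
      have h012 := Submodule.add_mem _ (hX 0) h12
      have IH : ∀ i j, Φ (T i) (g - e₃ j) = Φ' (T i) (g - e₃ j) := by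
        refine fun i j => ih _ (hT i) _ ?_
        push_cast at hg
        fin_cases j <;> simp [e₃] <;> omega
      rw [e, h.add hs h012, h'.add hs h012, h.add (hX 0) h12, h'.add (hX 0) h12,
        h.add (hX 1) (hX 2), h'.add (hX 1) (hX 2), h.const, h'.const]
      simp only [h.act _ (hT _), h'.act _ (hT _), aeval_X, Matrix.cons_val, act_add, Pi.add_apply,
        act_X, IH]
  funext g
  exact key (g.1 + g.2.1 + g.2.2 + 1).toNat D hD g (by omega)

end Slices

/-! ### Iterated substitutions -/

section Iterated

open MvPolynomial

variable {W : Type*} [AddCommGroup W] [Module ℂ W]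

lemma X_zero_dvd_sub_aeval (g : MvPolynomial (Fin 2) ℂ) :
    X 0 ∣ g - aeval ![0, X 1] g := by
  induction g using MvPolynomial.induction_on with
  | C c => simp
  | add p q hp hq =>
    rw [map_add (aeval _), add_sub_add_comm]
    exact dvd_add hp hq
  | mul_X p i hp =>
    rw [map_mul (aeval _), aeval_X]
    fin_cases i
    · simp
    · simpa [← sub_mul] using hp.mul_right (X 1)

/-- The exact power of the first variable dividing `p(x₀ + x, x)`. -/
lemma exists_aeval_θ₂_eq {p : MvPolynomial (Fin 2) ℂ} (hp : p ≠ 0) :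
    ∃ (k : ℕ) (g : MvPolynomial (Fin 2) ℂ), aeval θ₂ p = X 0 ^ k * g ∧
      aeval (![0, X 1] : Fin 2 → MvPolynomial (Fin 2) ℂ) g ≠ 0 := by
  obtain ⟨k, g, hg, he⟩ := WfDvdMonoid.max_power_factor' (aeval_θ₂_ne_zero hp)
    (X_prime (R := ℂ) (i := (0 : Fin 2))).not_isUnit
  refine ⟨k, g, he, fun h => hg ?_⟩
  have := X_zero_dvd_sub_aeval g
  rwa [h, sub_zero] at this

lemma exists_mem_support_of_aeval_ne_zero {H : MvPolynomial (Fin 3) ℂ}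
    (hH : aeval (![0, 0, X 1] : Fin 3 → MvPolynomial (Fin 2) ℂ) H ≠ 0) :
    ∃ d ∈ H.support, d 0 = 0 ∧ d 1 = 0 := by
  by_contra! hcon
  refine hH (aeval_eq_zero _ _ fun d hd => ?_)
  by_cases h0 : d 0 = 0
  · exact ⟨1, Finsupp.mem_support_iff.2 (hcon d (mem_support_iff.2 hd) h0), rfl⟩
  · exact ⟨0, Finsupp.mem_support_iff.2 h0, rfl⟩

/-- The three coordinates of `ℤ × ℤ × ℤ`. -/
def coord : Fin 3 → ℤ × ℤ × ℤ →+ ℤ :=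
  ![AddMonoidHom.fst _ _, (AddMonoidHom.fst _ _).comp (AddMonoidHom.snd _ _),
    (AddMonoidHom.snd _ _).comp (AddMonoidHom.snd _ _)]

lemma coord_zero (x y z : ℤ) : coord 0 (x, y, z) = x := rfl
lemma coord_one (x y z : ℤ) : coord 1 (x, y, z) = y := rfl
lemma coord_two (x y z : ℤ) : coord 2 (x, y, z) = z := rfl

lemma coord_wt (i : Fin 3) (d : Fin 3 →₀ ℕ) : coord i (wt e₃ d) = d i := by
  rw [wt_e₃]; fin_cases i <;> rfl

lemma lexHom_wt_injective (i j : Fin 3) (hij : i = 0 ∧ j = 1 ∨ i = 1 ∧ j = 0) :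
    Function.Injective fun d => lexHom (coord i) (coord j) (coord 2) (wt e₃ d) := by
  intro d d' h
  obtain ⟨h1, h2, h3⟩ := lexHom_injective _ _ _ _ _ h
  simp only [coord_wt, Nat.cast_inj] at h1 h2 h3
  ext l
  rcases hij with ⟨rfl, rfl⟩ | ⟨rfl, rfl⟩ <;> fin_cases l <;> assumption

/-- If a multiple of a family by a polynomial with a monomial free of the first two variables is a
power series, then the exponents of the first two variables in the family are nonnegative. -/
lemma eq_zero_of_act_mem_pow₃ {i j : Fin 3} (hij : i = 0 ∧ j = 1 ∨ i = 1 ∧ j = 0)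
    {H : MvPolynomial (Fin 3) ℂ} (hH : ∃ d ∈ H.support, d 0 = 0 ∧ d 1 = 0)
    {F : ℤ × ℤ × ℤ → W} (hF : F ∈ lexTrunc W (coord i) (coord j) (coord 2))
    (h : act e₃ H F ∈ pow₃ W) (g : ℤ × ℤ × ℤ) (hg : g.1 < 0 ∨ g.2.1 < 0) : F g = 0 := by
  obtain ⟨d, hd, hd0, hd1⟩ := hH
  obtain ⟨d₀, hd₀, hmin⟩ := Finset.exists_min_image H.support
    (fun d => lexHom (coord i) (coord j) (coord 2) (wt e₃ d)) ⟨d, hd⟩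
  have h00 : d₀ 0 = 0 ∧ d₀ 1 = 0 := by
    have := (lexHom_le _ _ _ _ _).1 (hmin d hd)
    simp only [coord_wt] at this
    rcases hij with ⟨rfl, rfl⟩ | ⟨rfl, rfl⟩ <;> omega
  refine act_vanish e₃ _ (lexHom_wt_injective i j hij) H d₀ hd₀ hmin
    {g | g.1 < 0 ∨ g.2.1 < 0} (fun g hg d _ => ?_) F hF.exists_min (fun g hg => ?_) g hg
  · simp only [Set.mem_ofPred_eq, wt_e₃, Prod.fst_sub, Prod.fst_add, Prod.snd_sub,
      Prod.snd_add] at hg ⊢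
    omega
  · refine h _ fun h' => ?_
    simp only [Set.mem_ofPred_eq, wt_e₃, Prod.le_def, Prod.fst_add, Prod.snd_add, Prod.fst_zero,
      Prod.snd_zero] at hg h'
    omega

/-- Families in `W((x))((x₀))((x₂))` and `W((x))((x₂))((x₀))` with a common multiple are equal up to
the factor removed. -/
lemma eq_of_act_eq_of_mem_pow₃ {H : MvPolynomial (Fin 3) ℂ}
    (hH : ∃ d ∈ H.support, d 0 = 0 ∧ d 1 = 0) {F F' : ℤ × ℤ × ℤ → W}
    (hF : F ∈ lexTrunc W (coord 1) (coord 0) (coord 2))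
    (hF' : F' ∈ lexTrunc W (coord 0) (coord 1) (coord 2))
    (h : act e₃ H F' ∈ pow₃ W) (he : act e₃ H F = act e₃ H F') : F = F' := by
  have hB := eq_zero_of_act_mem_pow₃ (Or.inl ⟨rfl, rfl⟩) hH hF' h
  have hF'' : F' ∈ lexTrunc W (coord 1) (coord 0) (coord 2) :=
    ⟨⟨0, fun g hg => hB g (Or.inr hg)⟩, fun _ => ⟨0, fun g _ hg => hB g (Or.inl hg)⟩,
      fun k k' => (hF'.2.2 k' k).imp fun j hj g hg hg' => hj g hg' hg⟩
  obtain ⟨d, hd, -⟩ := hH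
  exact act_cancel e₃ (lexHom_wt_injective 1 0 (Or.inr ⟨rfl, rfl⟩))
    (fun h0 => by simp [h0] at hd) hF hF'' he

lemma act_X_pow (i : Fin 3) (n : ℕ) (F : ℤ × ℤ × ℤ → W) (g : ℤ × ℤ × ℤ) :
    act e₃ (X i ^ n) F g = F (g - n • e₃ i) := by
  induction n generalizing g with
  | zero => simp
  | succ n ih => rw [pow_succ', act_mul, act_X, ih, succ_nsmul', sub_sub]

lemma act_X_pow_injective (i : Fin 3) (n : ℕ) :
    Function.Injective fun F : ℤ × ℤ × ℤ → W => act e₃ (X i ^ n) F := by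
  intro F F' h
  funext g
  have := congrFun h (g + n • e₃ i)
  simp only [act_X_pow, add_sub_cancel_right] at this
  exact this

/-- The slicing with last coordinate fixed. -/
def ρ₁₂ : ℤ × (ℤ × ℤ) ≃+ ℤ × ℤ × ℤ where
  toFun s := (s.2.1, s.2.2, s.1)
  invFun g := (g.2.2, g.1, g.2.1)
  left_inv _ := rfl
  right_inv _ := rfl
  map_add' _ _ := rfl

/-- The slicing with first coordinate fixed. -/
def ρ₂₃ : ℤ × (ℤ × ℤ) ≃+ ℤ × ℤ × ℤ := AddEquiv.refl _

/-- The slicing with middle coordinate fixed. -/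
def ρ₁₃ : ℤ × (ℤ × ℤ) ≃+ ℤ × ℤ × ℤ where
  toFun s := (s.2.1, s.1, s.2.2)
  invFun g := (g.2.1, g.1, g.2.2)
  left_inv _ := rfl
  right_inv _ := rfl
  map_add' _ _ := rfl

/-- The substitution adding the second to the first variable. -/
def θ₁₂ : Fin 3 → MvPolynomial (Fin 3) ℂ := ![X 0 + X 1, X 1, X 2]

/-- The substitution adding the third to the second variable. -/
def θ₂₃ : Fin 3 → MvPolynomial (Fin 3) ℂ := ![X 0, X 1 + X 2, X 2]

/-- The substitution adding the third to the first variable. -/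
def θ₁₃ : Fin 3 → MvPolynomial (Fin 3) ℂ := ![X 0 + X 2, X 1, X 2]

lemma isSlicing₁₂ : IsSlicing ρ₁₂ 0 1 2 θ₁₂ where
  e_u := rfl
  e_v := rfl
  e_w := rfl
  θ_u := rfl
  θ_v := rfl
  θ_w := rfl
  exhaust := by decide
  nonneg g := by
    simp only [ρ₁₂, Prod.le_def]
    exact ⟨fun h => ⟨h.2.2, h.1, h.2.1⟩, fun h => ⟨h.2.1, h.2.2, h.1⟩⟩

lemma isSlicing₂₃ : IsSlicing ρ₂₃ 1 2 0 θ₂₃ where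
  e_u := rfl
  e_v := rfl
  e_w := rfl
  θ_u := rfl
  θ_v := rfl
  θ_w := rfl
  exhaust := by decide
  nonneg _ := Iff.rfl

lemma isSlicing₁₃ : IsSlicing ρ₁₃ 0 2 1 θ₁₃ where
  e_u := rfl
  e_v := rfl
  e_w := rfl
  θ_u := rfl
  θ_v := rfl
  θ_w := rfl
  exhaust := by decide
  nonneg g := by
    simp only [ρ₁₃, Prod.le_def]
    exact ⟨fun h => ⟨h.2.1, h.1, h.2.2⟩, fun h => ⟨h.2.1, h.1, h.2.2⟩⟩

lemma aeval_θ₂₃_θ₁₂ : (fun i => aeval θ₂₃ (θ₁₂ i)) = ![X 0 + X 1 + X 2, X 1 + X 2, X 2] := by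
  funext i
  fin_cases i <;> simp [θ₂₃, θ₁₂, add_assoc]

lemma aeval_θ₁₂_θ₁₃_θ₂₃ : (fun i => aeval θ₁₂ (aeval θ₁₃ (θ₂₃ i))) =
    ![X 0 + X 1 + X 2, X 1 + X 2, X 2] := by
  funext i
  fin_cases i <;> simp [θ₂₃, θ₁₂, θ₁₃]

/-- Both ways of substituting `x₁ = x₀ + x₂ + x` and `y = x₂ + x` agree on power series. -/
lemma sliceSubst_comm {T : ℤ × ℤ × ℤ → W} (hT : T ∈ pow₃ W) :
    sliceSubst ρ₂₃ ch (sliceSubst ρ₁₂ ch T) =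
      sliceSubst ρ₁₂ ch (sliceSubst ρ₁₃ ch (sliceSubst ρ₂₃ ch T)) := by
  have h := isSlicing₁₂.isSubstOn (W := W) |>.comp isSlicing₂₃.isSubstOn
  have h' := (isSlicing₂₃.isSubstOn (W := W) |>.comp isSlicing₁₃.isSubstOn).comp
    isSlicing₁₂.isSubstOn
  rw [aeval_θ₂₃_θ₁₂] at h
  rw [aeval_θ₁₂_θ₁₃_θ₂₃] at h'
  exact h.unique h' hT

lemma substitutable_slice_ρ₁₂ {D : ℤ × ℤ × ℤ → W}
    (hD : D ∈ lexTrunc W (coord 1) (coord 0) (coord 2)) (k : ℤ) :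
    Substitutable ch' (slice ρ₁₂ k D) := by
  obtain ⟨⟨t₀, h⟩, -⟩ := hD
  exact substitutable_psi ⟨t₀, fun m t ht => h _ ht⟩

/-- The substitution `x₁ = x₀ + x₂`, expanded in nonnegative powers of `x₂`, preserves
lower truncation. -/
lemma sliceSubst_ch'_mem {D : ℤ × ℤ × ℤ → W}
    (hD : D ∈ lexTrunc W (coord 1) (coord 0) (coord 2)) :
    sliceSubst ρ₁₂ ch' D ∈ lexTrunc W (coord 1) (coord 0) (coord 2) := by
  obtain ⟨⟨t₀, h₁⟩, h₂, h₃⟩ := hD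
  choose j₂ h₂ using h₂
  choose j₃ h₃ using h₃
  have key : ∀ j t z, (∀ m, j ≤ m → t₀ ≤ t - m + j → j₂ (t - m + j) ≤ m →
      D (m, t - m + j, z) = 0) → sliceSubst ρ₁₂ ch' D (j, t, z) = 0 := by
    intro j t z h
    refine finsum_eq_zero_of_forall_eq_zero fun m => ?_
    change ch' m j • D (m, t - m + j, z) = 0
    rcases lt_or_ge m j with hm | hm
    · rw [ch', ch_of_neg _ (by omega), zero_smul]
    rcases lt_or_ge (t - m + j) t₀ with ht | ht
    · rw [h₁ _ ht, smul_zero]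
    rcases lt_or_ge m (j₂ (t - m + j)) with hm' | hm'
    · rw [h₂ _ (m, t - m + j, z) rfl hm', smul_zero]
    · rw [h m hm ht hm', smul_zero]
  refine ⟨⟨t₀, fun ⟨j, t, z⟩ hg => key j t z fun m hm ht _ => ?_⟩, fun t => ?_, fun t j => ?_⟩
  · rw [coord_one] at hg; omega
  · obtain ⟨B, hB⟩ := (Finset.Icc t₀ t).image j₂ |>.finite_toSet.bddBelow
    refine ⟨B - (t - t₀), ?_⟩
    rintro ⟨j, t', z⟩ ht hj
    rw [coord_one] at ht
    rw [coord_zero] at hj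
    subst ht
    refine key j t' z fun m hm ht hm' => ?_
    have := hB (Finset.mem_coe.2 (Finset.mem_image_of_mem j₂
      (Finset.mem_Icc.2 ⟨ht, (by omega : t' - m + j ≤ t')⟩)))
    omega
  · obtain ⟨B, hB⟩ := (Finset.Icc j (t - t₀ + j)).image (fun m => j₃ (t - m + j) m)
      |>.finite_toSet.bddBelow
    refine ⟨B, ?_⟩
    rintro ⟨j', t', z⟩ ht hj hz
    rw [coord_one] at ht
    rw [coord_zero] at hj
    rw [coord_two] at hz
    subst ht hj
    refine key j' t' z fun m hm ht hm' => h₃ (t' - m + j') m _ rfl rfl ?_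
    have := hB (Finset.mem_coe.2 (Finset.mem_image_of_mem (fun m => j₃ (t' - m + j') m)
      (Finset.mem_Icc.2 ⟨hm, (by omega : m ≤ t' - t₀ + j')⟩)))
    exact hz.trans_le this

end Iterated

/-! ### Weak associativity -/

section Associativity

open MvPolynomial

variable {W : Type*} [AddCommGroup W] [Module ℂ W]

lemma aeval_add_pair {A : Type*} [CommRing A] [Algebra ℂ A] (u v : A)
    {p g : MvPolynomial (Fin 2) ℂ} {k : ℕ} (h : aeval θ₂ p = X 0 ^ k * g) :
    aeval ![u + v, v] p = u ^ k * aeval ![u, v] g := by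
  have : (fun i => aeval ![u, v] (θ₂ i)) = ![u + v, v] := by
    funext i
    fin_cases i <;> simp [θ₂]
  rw [← this, ← comp_aeval_apply, h]
  simp

/-- The defining polynomial of quasi compatibility of triples, shifted by a monomial. -/
def triplePoly (p : MvPolynomial (Fin 2) ℂ) (N : ℕ) : MvPolynomial (Fin 3) ℂ :=
  (X 0 ^ N * (X 1 ^ N * X 2 ^ N)) * pairPoly p 3

lemma pairPoly_three (p : MvPolynomial (Fin 2) ℂ) :
    pairPoly p 3 = rename ![0, 1] p * (rename ![0, 2] p * rename ![1, 2] p) := by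
  have : (Finset.univ.filter fun ij : Fin 3 × Fin 3 => ij.1 < ij.2) =
      {(0, 1), (0, 2), (1, 2)} := by decide
  rw [pairPoly, this, Finset.prod_insert (by decide), Finset.prod_insert (by decide),
    Finset.prod_singleton]

lemma exists_aeval_triplePoly {p : MvPolynomial (Fin 2) ℂ} (hp : p ≠ 0) :
    ∃ k : ℕ, ∀ N, ∃ H : MvPolynomial (Fin 3) ℂ, (∃ d ∈ H.support, d 0 = 0 ∧ d 1 = 0) ∧
      aeval (![X 0 + X 1 + X 2, X 1 + X 2, X 2] : Fin 3 → MvPolynomial (Fin 3) ℂ)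
        (triplePoly p N) = H * (X 0 ^ k * (X 1 ^ k * (X 0 + X 1) ^ k)) := by
  obtain ⟨k, g, he, hg⟩ := exists_aeval_θ₂_eq hp
  refine ⟨k, fun N => ⟨((X 0 + X 1 + X 2) ^ N * ((X 1 + X 2) ^ N * X 2 ^ N)) *
    (aeval ![X 0, X 1 + X 2] g * (aeval ![X 0 + X 1, X 2] g * aeval ![X 1, X 2] g)),
    exists_mem_support_of_aeval_ne_zero ?_, ?_⟩⟩
  · have h : ∀ u v : MvPolynomial (Fin 3) ℂ,
        aeval (![0, 0, X 1] : Fin 3 → MvPolynomial (Fin 2) ℂ) u = 0 →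
        aeval (![0, 0, X 1] : Fin 3 → MvPolynomial (Fin 2) ℂ) v = X 1 →
        aeval (![0, 0, X 1] : Fin 3 → MvPolynomial (Fin 2) ℂ) (aeval ![u, v] g) ≠ 0 := by
      intro u v hu hv
      rw [comp_aeval_apply]
      convert hg using 4 with i
      fin_cases i
      · exact hu
      · exact hv
    simp only [map_mul (aeval _), map_pow (aeval _)]
    refine mul_ne_zero (mul_ne_zero (pow_ne_zero _ ?_) (mul_ne_zero (pow_ne_zero _ ?_)
      (pow_ne_zero _ ?_))) (mul_ne_zero (h _ _ ?_ ?_) (mul_ne_zero (h _ _ ?_ ?_) (h _ _ ?_ ?_)))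
    all_goals simp [X_ne_zero]
  · have h : ∀ (i j : Fin 3) (u v : MvPolynomial (Fin 3) ℂ),
        ![X 0 + X 1 + X 2, X 1 + X 2, X 2] i = u + v →
        ![X 0 + X 1 + X 2, X 1 + X 2, X 2] j = v →
        aeval (![X 0 + X 1 + X 2, X 1 + X 2, X 2] : Fin 3 → MvPolynomial (Fin 3) ℂ)
          (rename ![i, j] p) = u ^ k * aeval ![u, v] g := by
      intro i j u v hi hj
      rw [aeval_rename, ← aeval_add_pair u v he]
      congr 2
      funext l
      fin_cases l
      · exact hi
      · exact hj
    rw [triplePoly, pairPoly_three]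
    simp only [map_mul (aeval _), map_pow (aeval _)]
    rw [h 0 1 (X 0) (X 1 + X 2) (by simp [add_assoc]) (by simp),
      h 0 2 (X 0 + X 1) (X 2) (by simp) (by simp), h 1 2 (X 1) (X 2) (by simp) (by simp)]
    simp only [aeval_X, Matrix.cons_val]
    ring

/-- Weak associativity for families related by substitutions. -/
theorem exists_act_sliceSubst_eq {p : MvPolynomial (Fin 2) ℂ} (hp : p ≠ 0) :
    ∃ k : ℕ, ∀ (N : ℕ) (D Q R S L : ℤ × ℤ × ℤ → W), act e₃ (triplePoly p N) D ∈ pow₃ W →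
      (∀ i, Rel (slice ρ₁₂ i D) (slice ρ₁₂ i Q)) → (∀ i, Rel (slice ρ₂₃ i Q) (slice ρ₂₃ i R)) →
      (∀ i, Rel (slice ρ₂₃ i D) (slice ρ₂₃ i S)) → (∀ i, Rel (slice ρ₁₃ i S) (slice ρ₁₃ i L)) →
      R ∈ lexTrunc W (coord 0) (coord 1) (coord 2) →
      L ∈ lexTrunc W (coord 1) (coord 0) (coord 2) →
      act e₃ ((X 0 + X 1) ^ k) (sliceSubst ρ₁₂ ch' L) = act e₃ ((X 0 + X 1) ^ k) R := by
  obtain ⟨k, hk⟩ := exists_aeval_triplePoly hp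
  refine ⟨k, fun N D Q R S L hD hQ hR hS hL hRt hLt => ?_⟩
  obtain ⟨H, hH, he⟩ := hk N
  set P := triplePoly p N
  have hR' : act e₃ (aeval θ₂₃ (aeval θ₁₂ P)) R =
      sliceSubst ρ₂₃ ch (sliceSubst ρ₁₂ ch (act e₃ P D)) := by
    have h1 := isSlicing₁₂.eq_sliceSubst_of_rel hQ P hD
    have h2 := isSlicing₁₂.sliceSubst_ch_mem hD
    rw [← h1] at h2
    rw [isSlicing₂₃.eq_sliceSubst_of_rel hR _ h2, h1]
  have hL' : act e₃ (aeval θ₁₂ (aeval θ₁₃ (aeval θ₂₃ P))) (sliceSubst ρ₁₂ ch' L) =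
      sliceSubst ρ₁₂ ch (sliceSubst ρ₁₃ ch (sliceSubst ρ₂₃ ch (act e₃ P D))) := by
    have h1 := isSlicing₂₃.eq_sliceSubst_of_rel hS P hD
    have h2 := isSlicing₂₃.sliceSubst_ch_mem hD
    have h2' := h2
    rw [← h1] at h2'
    have h3 := isSlicing₁₃.eq_sliceSubst_of_rel hL _ h2'
    rw [h1] at h3
    have h4 := isSlicing₁₃.sliceSubst_ch_mem h2
    rw [isSlicing₁₂.act_sliceSubst ch'_succ (substitutable_slice_ρ₁₂ hLt), h3]
    refine slice_ext (ρ := ρ₁₂) fun i => ?_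
    rw [slice_sliceSubst, slice_sliceSubst]
    exact psi_eq_sig fun m t hm => isSlicing₁₂.slice_eq_zero h4 (Or.inr (Or.inl hm))
  rw [comp_aeval_apply, aeval_θ₂₃_θ₁₂, he, act_mul] at hR'
  rw [comp_aeval_apply _ (aeval θ₁₃), comp_aeval_apply, aeval_θ₁₂_θ₁₃_θ₂₃, he, ← sliceSubst_comm hD,
    act_mul] at hL'
  have hmem := isSlicing₂₃.sliceSubst_ch_mem (isSlicing₁₂.sliceSubst_ch_mem hD)
  rw [← hR'] at hmem
  have := eq_of_act_eq_of_mem_pow₃ hH (lexTrunc_act _ _ (sliceSubst_ch'_mem hLt))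
    (lexTrunc_act _ _ hRt) hmem (hL'.trans hR'.symm)
  rw [act_mul, act_mul, act_mul, act_mul] at this
  exact act_X_pow_injective 1 k (act_X_pow_injective 0 k this)

/-- Families of modes are lower truncated. -/
lemma mf_mem_lexTrunc {u : ℤ → ℤ → EW W} (h : ∃ N, ∀ n, N ≤ n → ∀ m, u n m = 0)
    (h' : ∀ n, ∃ N, ∀ m, N ≤ m → u n m = 0) (w : W) (i j : Fin 3) :
    (fun g => mf (u (-coord i g - 1) (-coord j g - 1)) w (-coord 2 g - 1)) ∈
      lexTrunc W (coord i) (coord j) (coord 2) := by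
  obtain ⟨N, hN⟩ := h
  refine ⟨⟨-N, fun g hg => ?_⟩, fun k => ?_, fun k k' => ?_⟩
  · simp only [hN _ (by omega : N ≤ -coord i g - 1)]
    rfl
  · obtain ⟨N, hN⟩ := h' (-k - 1)
    refine ⟨-N, fun g hg hg' => ?_⟩
    simp only [hg, hN _ (by omega : N ≤ -coord j g - 1)]
    rfl
  · obtain ⟨N, hN⟩ := exists_mf_eq_zero (u (-k - 1) (-k' - 1)) w
    refine ⟨-N, fun g hg hg' hg'' => ?_⟩
    simp only [hg, hg', hN _ (by omega : N ≤ -coord 2 g - 1)]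

/-- The coefficients of `a(x) b(y) c(z) w`. -/
def tripleFam (a b c : EW W) (w : W) (g : ℤ × ℤ × ℤ) : W :=
  mf a (mf b (mf c w (-g.2.2 - 1)) (-g.2.1 - 1)) (-g.1 - 1)

lemma mulPolyN_seqCoeff (P : MvPolynomial (Fin 3) ℂ) (a b c : EW W) (w : W) (g : ℤ × ℤ × ℤ) :
    mulPolyN P (seqCoeff ![a, b, c] w) ![g.1, g.2.1, g.2.2] = act e₃ P (tripleFam a b c w) g := by
  rw [act_apply]
  refine Finset.sum_congr rfl fun d _ => ?_
  rw [wt_e₃]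
  rfl

lemma QCSeq.exists_triplePoly {a b c : EW W} (h : QCSeq ![a, b, c]) :
    ∃ p : MvPolynomial (Fin 2) ℂ, p ≠ 0 ∧
      ∀ w, ∃ N, act e₃ (triplePoly p N) (tripleFam a b c w) ∈ pow₃ W := by
  obtain ⟨p, hp, hL⟩ := h
  refine ⟨p, hp, fun w => ?_⟩
  obtain ⟨N, hN⟩ := hL w
  refine ⟨(-N).toNat, fun g hg => ?_⟩
  rw [triplePoly, act_mul, act_mul, act_mul, act_X_pow, act_X_pow, act_X_pow,
    ← mulPolyN_seqCoeff]
  refine hN _ ?_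
  obtain ⟨x, y, z⟩ := g
  simp only [Prod.le_def, Prod.fst_zero, Prod.snd_zero] at hg
  simp only [Fin.exists_fin_succ, e₃, Matrix.cons_val, Prod.smul_mk, Prod.mk_sub_mk]
  simp
  omega

lemma QCPair.zero_right (a : EW W) : QCPair a 0 :=
  ⟨1, one_ne_zero, fun w => ⟨0, fun m t _ => by
    rw [mulPoly_eq, map_one]
    exact (mode a (-m - 1)).map_zero⟩⟩

lemma QCPair.zero_left (b : EW W) : QCPair 0 b :=
  ⟨1, one_ne_zero, fun w => ⟨0, fun m t _ => by
    rw [mulPoly_eq, map_one]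
    rfl⟩⟩

lemma YE_zero_left (b : EW W) (n : ℤ) : YE 0 b n = 0 := by
  simpa using YE_smul_left (a := 0) 0 (QCPair.zero_left b) (by simpa using QCPair.zero_left b) n

lemma YE_zero_right (a : EW W) (n : ℤ) : YE a 0 n = 0 := by
  simpa using YE_smul_right (b := 0) 0 (QCPair.zero_right a) (by simpa using QCPair.zero_right a) n

/-- Weak associativity of the operation `Y_ℰ`. -/
theorem exists_act_psi_YE_eq {a b c : EW W} (h : QCSeq ![a, b, c]) (hab : QCPair a b)
    (hbc : QCPair b c) (habc : ∀ n, QCPair (YE a b n) c) (habc' : ∀ n, QCPair a (YE b c n)) :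
    ∃ k : ℕ, ∀ w z, act e₂ ((X 0 + X 1) ^ k)
        (psi fun s => mf (YE a (YE b c (-s.2 - 1)) (-s.1 - 1)) w (-z - 1)) =
      act e₂ ((X 0 + X 1) ^ k)
        (fun s => mf (YE (YE a b (-s.1 - 1)) c (-s.2 - 1)) w (-z - 1)) := by
  obtain ⟨p, hp, hN⟩ := h.exists_triplePoly
  obtain ⟨k, hk⟩ := exists_act_sliceSubst_eq (W := W) hp
  refine ⟨k, fun w z => ?_⟩
  obtain ⟨N, hN⟩ := hN w
  have h1 : ∀ i, Rel (slice ρ₁₂ i (tripleFam a b c w))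
      (slice ρ₁₂ i fun g => YEFam a b (mf c w (-g.2.2 - 1)) (g.1, g.2.1)) :=
    fun i => YEFam_rel hab (mf c w (-i - 1))
  have h2 : ∀ i, Rel (slice ρ₂₃ i fun g => YEFam a b (mf c w (-g.2.2 - 1)) (g.1, g.2.1))
      (slice ρ₂₃ i fun g => mf (YE (YE a b (-g.1 - 1)) c (-g.2.1 - 1)) w (-g.2.2 - 1)) :=
    fun i => YEFam_rel (habc (-i - 1)) w
  have h3 : ∀ i, Rel (slice ρ₂₃ i (tripleFam a b c w))
      (slice ρ₂₃ i fun g => mode a (-g.1 - 1) (YEFam b c w g.2)) :=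
    fun i => (YEFam_rel hbc w).map (mode a (-i - 1))
  have h4 : ∀ i, Rel (slice ρ₁₃ i fun g => mode a (-g.1 - 1) (YEFam b c w g.2))
      (slice ρ₁₃ i fun g => mf (YE a (YE b c (-g.2.1 - 1)) (-g.1 - 1)) w (-g.2.2 - 1)) :=
    fun i => YEFam_rel (habc' (-i - 1)) w
  obtain ⟨M, hM⟩ := exists_YE_eq_zero hab
  obtain ⟨M', hM'⟩ := exists_YE_eq_zero hbc
  have h5 := mf_mem_lexTrunc (u := fun n m => YE (YE a b n) c m)
    ⟨M, fun n hn m => by simp only [hM n hn, YE_zero_left]⟩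
    (fun n => exists_YE_eq_zero (habc n)) w 0 1
  have h6 := mf_mem_lexTrunc (u := fun n m => YE a (YE b c n) m)
    ⟨M', fun n hn m => by simp only [hM' n hn, YE_zero_right]⟩
    (fun n => exists_YE_eq_zero (habc' n)) w 1 0
  have key := congrArg (slice ρ₁₂ z) (hk N _ _ _ _ _ hN h1 h2 h3 h4 h5 h6)
  have hX : ((X 0 + X 1) ^ k : MvPolynomial (Fin 3) ℂ) =
      rename ![0, 1] ((X 0 + X 1) ^ k : MvPolynomial (Fin 2) ℂ) := by simp
  rw [hX, isSlicing₁₂.slice_act_rename, isSlicing₁₂.slice_act_rename, slice_sliceSubst] at key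
  exact key

end Associativity

/-! ### The nonlocal vertex algebra and its quasi module -/

section Main

open MvPolynomial

variable {W : Type*} [AddCommGroup W] [Module ℂ W]

/-- The vertex operator map `Y_ℰ` of a closed quasi compatible subspace. -/
def vertexOp (V : Submodule ℂ (EW W)) (hqc : ∀ a ∈ V, ∀ b ∈ V, QCPair a b)
    (hclosed : ∀ a ∈ V, ∀ b ∈ V, ∀ n : ℤ, YE a b n ∈ V) : ↥V →ₗ[ℂ] EW ↥V where
  toFun a := ⟨{ toFun := fun b n => ⟨YE (a : EW W) (b : EW W) n, hclosed _ a.2 _ b.2 n⟩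
                map_add' := fun b b' => funext fun n => Subtype.ext <|
                  YE_add_right (hqc _ a.2 _ b.2) (hqc _ a.2 _ b'.2) (hqc _ a.2 _ (b + b').2) n
                map_smul' := fun c b => funext fun n => Subtype.ext <|
                  YE_smul_right c (hqc _ a.2 _ b.2) (hqc _ a.2 _ (c • b).2) n },
    fun b => (exists_YE_eq_zero (hqc _ a.2 _ b.2)).imp fun _ hN n hn => Subtype.ext (hN n hn)⟩
  map_add' a a' := EW_ext fun b n => Subtype.ext <|
    YE_add_left (hqc _ a.2 _ b.2) (hqc _ a'.2 _ b.2) (hqc _ (a + a').2 _ b.2) n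
  map_smul' c a := EW_ext fun b n => Subtype.ext <|
    YE_smul_left c (hqc _ a.2 _ b.2) (hqc _ (c • a).2 _ b.2) n

/-- The vertex operator map `Y_ℰ` of a closed quasi compatible subspace is weakly associative. -/
lemma vertexOp_wassoc (V : Submodule ℂ (EW W)) (hqc : ∀ a ∈ V, ∀ b ∈ V, QCPair a b)
    (hqc₃ : ∀ a ∈ V, ∀ b ∈ V, ∀ c ∈ V, QCSeq ![a, b, c])
    (hclosed : ∀ a ∈ V, ∀ b ∈ V, ∀ n : ℤ, YE a b n ∈ V) (u v c : ↥V) :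
    ∃ l : ℕ, ∀ i j : ℤ,
      mulSubPoly (X 0 ^ l) (prodCE (fun x => mf (vertexOp V hqc hclosed x))
        (fun x => mf (vertexOp V hqc hclosed x)) u v c) i j =
      mulSubPoly (X 0 ^ l) (assocCE (fun x y n => mf (vertexOp V hqc hclosed x) y n)
        (fun x => mf (vertexOp V hqc hclosed x)) u v c) i j := by
  obtain ⟨l, hl⟩ := exists_act_psi_YE_eq (hqc₃ _ u.2 _ v.2 _ c.2) (hqc _ u.2 _ v.2)
    (hqc _ v.2 _ c.2) (fun n => hqc _ (hclosed _ u.2 _ v.2 n) _ c.2)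
    (fun n => hqc _ u.2 _ (hclosed _ v.2 _ c.2 n))
  refine ⟨l, fun i j => ?_⟩
  have hθ : aeval θ₂ (X 0 ^ l : MvPolynomial (Fin 2) ℂ) = (X 0 + X 1) ^ l := by simp [θ₂]
  rw [mulSubPoly_eq, mulSubPoly_eq, hθ]
  simp only [prodCE_eq]
  refine Subtype.ext (EW_ext fun w n => ?_)
  have hs : Substitutable ch' (fun s : ℤ × ℤ => mf (vertexOp V hqc hclosed u)
      (mf (vertexOp V hqc hclosed v) c (-s.2 - 1)) (-s.1 - 1)) := by
    obtain ⟨N, hN⟩ := exists_mf_eq_zero (vertexOp V hqc hclosed v) c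
    refine substitutable_psi ⟨-N, fun m t ht => ?_⟩
    simp only [hN _ (by omega : N ≤ -t - 1)]
    exact (mode (vertexOp V hqc hclosed u) (-m - 1)).map_zero
  let φ : ↥V →ₗ[ℂ] W := modeAt w n ∘ₗ V.subtype
  have key := congrFun (hl w (-n - 1)) (i, j)
  rw [show -(-n - 1) - 1 = n by ring] at key
  have e1 := congrFun (act_comp e₂ ((X 0 + X 1) ^ l) φ (psi fun s : ℤ × ℤ =>
    mf (vertexOp V hqc hclosed u) (mf (vertexOp V hqc hclosed v) c (-s.2 - 1)) (-s.1 - 1))) (i, j)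
  rw [← subst_comp hs φ] at e1
  have e2 := congrFun (act_comp e₂ ((X 0 + X 1) ^ l) φ fun s : ℤ × ℤ =>
    assocCE (fun x y n => mf (vertexOp V hqc hclosed x) y n)
        (fun x => mf (vertexOp V hqc hclosed x)) u v c s.1 s.2) (i, j)
  exact e1.symm.trans (key.trans e2)

/-- Associativity of the action of a quasi compatible pair, up to a polynomial factor. -/
lemma QCPair.exists_act_psi_eq {a b : EW W} (h : QCPair a b) (w : W) :
    ∃ f : MvPolynomial (Fin 2) ℂ, f ≠ 0 ∧
      act e₂ (aeval θ₂ f) (psi (prodFam a b w)) = act e₂ (aeval θ₂ f) (YEFam a b w) := by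
  obtain ⟨hp, hL⟩ := h.exists_poly
  obtain ⟨N, hN⟩ := hL w
  have hs : Substitutable ch' (prodFam a b w) := by
    obtain ⟨M, hM⟩ := exists_mf_eq_zero b w
    refine substitutable_psi ⟨-M, fun m t ht => ?_⟩
    rw [prodFam, Fab, hM _ (by omega : M ≤ -t - 1)]
    exact (mode a (-m - 1)).map_zero
  have hX : ∀ (n : ℕ) (F : ℤ × ℤ → W) (m t : ℤ),
      act e₂ (X 0 ^ n) F (m, t) = F (m - n, t) := by
    intro n F m t
    rw [X_pow_eq_monomial, act_monomial, wt_e₂]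
    simp
  refine ⟨X 0 ^ (-N).toNat * h.choose, mul_ne_zero (pow_ne_zero _ (X_ne_zero _)) hp, ?_⟩
  have h1 := ((subst_isSemilinear ch'_succ).act (X 0 ^ (-N).toNat * h.choose)
    ⟨hs, rfl⟩).2
  refine h1.trans ?_
  rw [(YEFam_rel h w).act_eq _ (by rw [act_mul]; exact laur₂_act _ (hL w))]
  refine psi_eq_sig fun m t hm => ?_
  rw [act_mul, hX]
  exact hN _ _ (Or.inl (by omega))

end Main

/-- cf. Theorem 2.9.  Let `W` be a vector space over `ℂ` and
let `V ⊆ ℰ(W) = Hom(W, W((x)))` be a subspace such that every ordered sequence in `V`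
of length 2 or 3 is quasi compatible, containing the identity operator `1_W`, and
closed under all the products `a(x)ₙ b(x)`.  Then `(V, Y_ℰ, 1_W)` carries the
structure of a nonlocal vertex algebra, and `W` is a faithful quasi `V`-module with
`Y_W(α(x), x₀) = α(x₀)`. -/
theorem statement0 {W : Type*} [AddCommGroup W] [Module ℂ W]
    (V : Submodule ℂ (EW W))
    (h2 : ∀ ψ : Fin 2 → EW W, (∀ i, ψ i ∈ V) → QCSeq ψ)
    (h3 : ∀ ψ : Fin 3 → EW W, (∀ i, ψ i ∈ V) → QCSeq ψ)
    (hone : oneE ∈ V)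
    (hclosed : ∀ a ∈ V, ∀ b ∈ V, ∀ n : ℤ, YE a b n ∈ V) :
    ∃ A : NLVA ↥V, (A.one : EW W) = oneE ∧
      (∀ (a b : ↥V) (n : ℤ), ((Yf A a b n : ↥V) : EW W) = YE (a : EW W) (b : EW W) n) ∧
      IsQuasiModule A V.subtype ∧ Function.Injective V.subtype := by
  have hqc : ∀ a ∈ V, ∀ b ∈ V, QCPair a b := fun a ha b hb =>
    (h2 ![a, b] (by simp [Fin.forall_fin_succ, ha, hb])).qcPair
  have hqc₃ : ∀ a ∈ V, ∀ b ∈ V, ∀ c ∈ V, QCSeq ![a, b, c] := fun a ha b hb c hc =>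
    h3 ![a, b, c] (by simp [Fin.forall_fin_succ, ha, hb, hc])
  refine ⟨{ Y := vertexOp V hqc hclosed
            one := ⟨oneE, hone⟩
            vac := fun v n => Subtype.ext <| (YE_oneE_left (hqc _ hone _ v.2) n).trans ?_
            creation0 := fun v n hn =>
              Subtype.ext ((YE_oneE_right (hqc _ v.2 _ hone)).1 n hn)
            creation1 := fun v => Subtype.ext (YE_oneE_right (hqc _ v.2 _ hone)).2
            wassoc := vertexOp_wassoc V hqc hqc₃ hclosed },
    rfl, fun _ _ _ => rfl, ⟨fun w n => mf_oneE w n, fun u v w => ?_⟩, Subtype.val_injective⟩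
  · split_ifs <;> rfl
  · obtain ⟨f, hf, h⟩ := (hqc _ u.2 _ v.2).exists_act_psi_eq w
    refine ⟨f, hf, fun i j => ?_⟩
    rw [mulSubPoly_eq, mulSubPoly_eq]
    simp only [prodCE_eq]
    exact congrFun h (i, j)

end NVA
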